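/- arXiv:2201.02496 — 4 statements merged into one kernel-verified Lean document; each statement's English description precedes it below -/
import Mathlib

section
/- Let !Γ,Δ ⊢ Π be a !-prenex {⊗,⊸,&,⊕,1,⊥}-sequent. If !Γ,Δ ⊢ Π is provable in ILZW', then there exists n ≥ 0 such that Γ^n,Δ ⊢ Π is provable in FLew. -/
namespace Affine

/-- Intuitionistic formulas: the language 𝓛 (⊗, ⊸, &, ⊕, !, 1, ⊤, ⊥, 0)
together with the extra ILAL modality §. -/
inductive IForm : Type where
  | var (n : ℕ)
  | one
  | top
  | bot
  | zero
  | tensor (A B : IForm)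
  | limp (A B : IForm)
  | and (A B : IForm)
  | or (A B : IForm)
  | bang (A : IForm)
  | para (A : IForm)

namespace IForm

/-- membership in the language 𝓛 (no §) -/
def inL : IForm → Prop
  | para _ => False
  | tensor A B => inL A ∧ inL B
  | limp A B => inL A ∧ inL B
  | and A B => inL A ∧ inL B
  | or A B => inL A ∧ inL B
  | bang A => inL A
  | _ => True

/-- membership in the ⊥-free language 𝓛⁺ -/
def inLp : IForm → Prop
  | para _ => False
  | bot => False
  | tensor A B => inLp A ∧ inLp B
  | limp A B => inLp A ∧ inLp B
  | and A B => inLp A ∧ inLp B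
  | or A B => inLp A ∧ inLp B
  | bang A => inLp A
  | _ => True

/-- {⊗,⊸,&,⊕,1,⊥}-formulas -/
def inFLei : IForm → Prop
  | var _ => True
  | one => True
  | bot => True
  | tensor A B => inFLei A ∧ inFLei B
  | limp A B => inFLei A ∧ inFLei B
  | and A B => inFLei A ∧ inFLei B
  | or A B => inFLei A ∧ inFLei B
  | _ => False

/-- {⊗,⊸,&,⊕,1}-formulas -/
def inFLeiP : IForm → Prop
  | var _ => True
  | one => True
  | tensor A B => inFLeiP A ∧ inFLeiP B
  | limp A B => inFLeiP A ∧ inFLeiP B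
  | and A B => inFLeiP A ∧ inFLeiP B
  | or A B => inFLeiP A ∧ inFLeiP B
  | _ => False

/-- purely implicational ({⊸}-) formulas -/
def inImp : IForm → Prop
  | var _ => True
  | limp A B => inImp A ∧ inImp B
  | _ => False

/-- {⊸,!}-formulas -/
def inImpBang : IForm → Prop
  | var _ => True
  | limp A B => inImpBang A ∧ inImpBang B
  | bang A => inImpBang A
  | _ => False

/-- {⊸,!,§}-formulas: the language of ILAL -/
def inLAL : IForm → Prop
  | var _ => True
  | limp A B => inLAL A ∧ inLAL B
  | bang A => inLAL A
  | para A => inLAL A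
  | _ => False

end IForm

/-- A parametrized intuitionistic sequent calculus: `K` is the set of allowed
formulas (the fragment), `ax` the set of non-logical axioms, and the remaining
fields tell which optional rules are available. -/
structure ICalc where
  K : IForm → Prop
  ax : Set IForm
  wL : Prop      -- unrestricted left weakening (W)
  wR : Prop      -- right weakening (W')
  bD : Prop      -- dereliction (!D)
  bP : Prop      -- promotion (!P)
  bF : Prop      -- functorial promotion (!F)
  bW : Prop      -- !-weakening (!W), for linear systems
  lB : Prop      -- the ILAL rule (!)
  lP : Prop      -- the ILAL rule (§)

/-- Provability of an intuitionistic sequent `Γ ⊢ X` (X a stoup) in the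
parametrized calculus `C`. -/
inductive IPrv (C : ICalc) : Multiset IForm → Option IForm → Prop where
  | axiom' {B} : B ∈ C.ax → IPrv C 0 (some B)
  | init {A} : C.K A → IPrv C {A} (some A)
  | oneR : C.K .one → IPrv C 0 (some .one)
  | botL : C.K .bot → IPrv C {.bot} none
  | topR {Γ} : C.K .top → (∀ A ∈ Γ, C.K A) → IPrv C Γ (some .top)
  | zeroL {Γ X} : C.K .zero → (∀ A ∈ Γ, C.K A) → (∀ A, X = some A → C.K A) →
      IPrv C (.zero ::ₘ Γ) X
  | cut {Γ Δ X A} : IPrv C Γ (some A) → IPrv C (A ::ₘ Δ) X → IPrv C (Γ + Δ) X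
  | oneL {Γ X} : C.K .one → IPrv C Γ X → IPrv C (.one ::ₘ Γ) X
  | botR {Γ} : C.K .bot → IPrv C Γ none → IPrv C Γ (some .bot)
  | limpL {Γ Δ X A B} : C.K (.limp A B) → IPrv C Γ (some A) → IPrv C (B ::ₘ Δ) X →
      IPrv C (.limp A B ::ₘ (Γ + Δ)) X
  | limpR {Γ A B} : C.K (.limp A B) → IPrv C (A ::ₘ Γ) (some B) →
      IPrv C Γ (some (.limp A B))
  | tensorL {Γ X A B} : C.K (.tensor A B) → IPrv C (A ::ₘ B ::ₘ Γ) X →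
      IPrv C (.tensor A B ::ₘ Γ) X
  | tensorR {Γ Δ A B} : C.K (.tensor A B) → IPrv C Γ (some A) → IPrv C Δ (some B) →
      IPrv C (Γ + Δ) (some (.tensor A B))
  | withL1 {Γ X A B} : C.K (.and A B) → IPrv C (A ::ₘ Γ) X → IPrv C (.and A B ::ₘ Γ) X
  | withL2 {Γ X A B} : C.K (.and A B) → IPrv C (B ::ₘ Γ) X → IPrv C (.and A B ::ₘ Γ) X
  | withR {Γ A B} : C.K (.and A B) → IPrv C Γ (some A) → IPrv C Γ (some B) →
      IPrv C Γ (some (.and A B))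
  | plusL {Γ X A B} : C.K (.or A B) → IPrv C (A ::ₘ Γ) X → IPrv C (B ::ₘ Γ) X →
      IPrv C (.or A B ::ₘ Γ) X
  | plusR1 {Γ A B} : C.K (.or A B) → IPrv C Γ (some A) → IPrv C Γ (some (.or A B))
  | plusR2 {Γ A B} : C.K (.or A B) → IPrv C Γ (some B) → IPrv C Γ (some (.or A B))
  | bangD {Γ X A} : C.bD → C.K (.bang A) → IPrv C (A ::ₘ Γ) X → IPrv C (.bang A ::ₘ Γ) X
  | bangP {Γ : Multiset IForm} {A} : C.bP → C.K (.bang A) → (∀ B ∈ Γ, C.K (.bang B)) →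
      IPrv C (Γ.map .bang) (some A) → IPrv C (Γ.map .bang) (some (.bang A))
  | bangF {Γ : Multiset IForm} {A} : C.bF → C.K (.bang A) → (∀ B ∈ Γ, C.K (.bang B)) →
      IPrv C Γ (some A) → IPrv C (Γ.map .bang) (some (.bang A))
  | weakL {Γ X A} : C.wL → C.K A → IPrv C Γ X → IPrv C (A ::ₘ Γ) X
  | bangW {Γ X A} : C.bW → C.K (.bang A) → IPrv C Γ X → IPrv C (.bang A ::ₘ Γ) X
  | bangC {Γ X A} : C.K (.bang A) → IPrv C (.bang A ::ₘ .bang A ::ₘ Γ) X →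
      IPrv C (.bang A ::ₘ Γ) X
  | weakR {Γ A} : C.wR → C.K A → IPrv C Γ none → IPrv C Γ (some A)
  | lalBang {A} {E : Multiset IForm} : C.lB → C.K (.bang A) →
      (∀ B ∈ E, C.K (.bang B)) → Multiset.card E ≤ 1 → IPrv C E (some A) →
      IPrv C (E.map .bang) (some (.bang A))
  | lalPara {Γ Δ : Multiset IForm} {A} : C.lP → C.K (.para A) → (∀ B ∈ Γ, C.K (.bang B)) →
      (∀ B ∈ Δ, C.K (.para B)) → IPrv C (Γ + Δ) (some A) →
      IPrv C (Γ.map .bang + Δ.map .para) (some (.para A))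

/-- ILZW with a set of non-logical axioms. -/
def ILZWc (Φ : Set IForm) : ICalc :=
  ⟨IForm.inL, Φ, True, False, True, True, False, False, False, False⟩

/-- ILZW' = ILZW + right weakening, with a set of non-logical axioms. -/
def ILZWpc (Φ : Set IForm) : ICalc :=
  ⟨IForm.inL, Φ, True, True, True, True, False, False, False, False⟩

/-- ILLW: the ⊥-free fragment of ILZW. -/
def ILLWc (Φ : Set IForm) : ICalc :=
  ⟨IForm.inLp, Φ, True, False, True, True, False, False, False, False⟩

/-- IEZW: intuitionistic elementary affine logic with bottom. -/
def IEZWc (Φ : Set IForm) : ICalc :=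
  ⟨IForm.inL, Φ, True, False, False, False, True, False, False, False⟩

/-- IELW: the ⊥-free fragment of IEZW. -/
def IELWc (Φ : Set IForm) : ICalc :=
  ⟨IForm.inLp, Φ, True, False, False, False, True, False, False, False⟩

/-- FLei: the {⊗,⊸,&,⊕,1,⊥}-fragment of ILZW. -/
def FLeic (Φ : Set IForm) : ICalc :=
  ⟨IForm.inFLei, Φ, True, False, True, True, False, False, False, False⟩

/-- FLew: the {⊗,⊸,&,⊕,1,⊥}-fragment of ILZW'. -/
def FLewc (Φ : Set IForm) : ICalc :=
  ⟨IForm.inFLei, Φ, True, True, True, True, False, False, False, False⟩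

/-- FLei⁺: the {⊗,⊸,&,⊕,1}-fragment of ILZW. -/
def FLeiPc (Φ : Set IForm) : ICalc :=
  ⟨IForm.inFLeiP, Φ, True, False, True, True, False, False, False, False⟩

/-- BCK: the {⊸}-fragment of ILZW. -/
def BCKc (Φ : Set IForm) : ICalc :=
  ⟨IForm.inImp, Φ, True, False, True, True, False, False, False, False⟩

/-- The {⊸,!}-fragment of ILLW. -/
def ImpBangILLWc (Φ : Set IForm) : ICalc :=
  ⟨IForm.inImpBang, Φ, True, False, True, True, False, False, False, False⟩

/-- ILL: intuitionistic linear logic (no unrestricted weakening, only !W). -/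
def ILLc (Φ : Set IForm) : ICalc :=
  ⟨IForm.inLp, Φ, False, False, True, True, False, True, False, False⟩

/-- BCI: the {⊸}-fragment of ILL. -/
def BCIc (Φ : Set IForm) : ICalc :=
  ⟨IForm.inImp, Φ, False, False, True, True, False, True, False, False⟩

/-- ILAL: intuitionistic light affine logic. -/
def ILALc (Φ : Set IForm) : ICalc :=
  ⟨IForm.inLAL, Φ, True, False, False, False, False, False, True, True⟩

/-- Classical formulas: literals p, p⊥ and the connectives ⊗, ⅋, &, ⊕, 1, ⊥, ⊤, 0, !, ?. -/
inductive CForm : Type where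
  | pos (n : ℕ)
  | neg (n : ℕ)
  | one
  | bot
  | top
  | zero
  | tensor (A B : CForm)
  | par (A B : CForm)
  | and (A B : CForm)
  | or (A B : CForm)
  | bang (A : CForm)
  | quest (A : CForm)

namespace CForm

/-- De Morgan (involutive) negation. -/
def dual : CForm → CForm
  | pos n => neg n
  | neg n => pos n
  | one => bot
  | bot => one
  | top => zero
  | zero => top
  | tensor A B => par A.dual B.dual
  | par A B => tensor A.dual B.dual
  | and A B => or A.dual B.dual
  | or A B => and A.dual B.dual
  | bang A => quest A.dual
  | quest A => bang A.dual

/-- the propositional variable `x` occurs in the formula -/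
def hasVar (x : ℕ) : CForm → Prop
  | pos n => n = x
  | neg n => n = x
  | one => False
  | bot => False
  | top => False
  | zero => False
  | tensor A B => hasVar x A ∨ hasVar x B
  | par A B => hasVar x A ∨ hasVar x B
  | and A B => hasVar x A ∨ hasVar x B
  | or A B => hasVar x A ∨ hasVar x B
  | bang A => hasVar x A
  | quest A => hasVar x A

/-- {⊗,⅋,&,⊕,1,⊥}-formulas (the language of InFLew) -/
def inMALL : CForm → Prop
  | pos _ => True
  | neg _ => True
  | one => True
  | bot => True
  | tensor A B => inMALL A ∧ inMALL B
  | par A B => inMALL A ∧ inMALL B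
  | and A B => inMALL A ∧ inMALL B
  | or A B => inMALL A ∧ inMALL B
  | _ => False

end CForm

/-- A parametrized one-sided classical sequent calculus. -/
structure CCalc where
  K : CForm → Prop
  ax : Set CForm
  wk : Prop      -- unrestricted weakening (W)
  der : Prop     -- dereliction (?)
  prom : Prop    -- promotion (!)
  funcF : Prop   -- the functorial rule (F) of ELLW
  qW : Prop      -- ?-weakening (?W), for LL

/-- Provability of a one-sided sequent `⊢ Γ` in the parametrized calculus `C`. -/
inductive CPrv (C : CCalc) : Multiset CForm → Prop where
  | axiom' {B} : B ∈ C.ax → CPrv C {B}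
  | init {A} : C.K A → C.K A.dual → CPrv C {A, A.dual}
  | one : C.K .one → CPrv C {.one}
  | top {Γ} : C.K .top → (∀ A ∈ Γ, C.K A) → CPrv C (.top ::ₘ Γ)
  | cut {Γ Δ A} : CPrv C (A ::ₘ Γ) → CPrv C (A.dual ::ₘ Δ) → CPrv C (Γ + Δ)
  | bot {Γ} : C.K .bot → CPrv C Γ → CPrv C (.bot ::ₘ Γ)
  | tensor {Γ Δ A B} : C.K (.tensor A B) → CPrv C (A ::ₘ Γ) → CPrv C (B ::ₘ Δ) →
      CPrv C (.tensor A B ::ₘ (Γ + Δ))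
  | par {Γ A B} : C.K (.par A B) → CPrv C (A ::ₘ B ::ₘ Γ) → CPrv C (.par A B ::ₘ Γ)
  | with' {Γ A B} : C.K (.and A B) → CPrv C (A ::ₘ Γ) → CPrv C (B ::ₘ Γ) →
      CPrv C (.and A B ::ₘ Γ)
  | plus1 {Γ A B} : C.K (.or A B) → CPrv C (A ::ₘ Γ) → CPrv C (.or A B ::ₘ Γ)
  | plus2 {Γ A B} : C.K (.or A B) → CPrv C (B ::ₘ Γ) → CPrv C (.or A B ::ₘ Γ)
  | der {Γ A} : C.der → C.K (.quest A) → CPrv C (A ::ₘ Γ) → CPrv C (.quest A ::ₘ Γ)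
  | prom {Γ : Multiset CForm} {A} : C.prom → C.K (.bang A) → (∀ B ∈ Γ, C.K (.quest B)) →
      CPrv C (A ::ₘ Γ.map .quest) → CPrv C (.bang A ::ₘ Γ.map .quest)
  | wk {Γ A} : C.wk → C.K A → CPrv C Γ → CPrv C (A ::ₘ Γ)
  | questW {Γ A} : C.qW → C.K (.quest A) → CPrv C Γ → CPrv C (.quest A ::ₘ Γ)
  | questC {Γ A} : C.K (.quest A) → CPrv C (.quest A ::ₘ .quest A ::ₘ Γ) →
      CPrv C (.quest A ::ₘ Γ)
  | funcF {Γ : Multiset CForm} {A} : C.funcF → C.K (.bang A) → (∀ B ∈ Γ, C.K (.quest B)) →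
      CPrv C (A ::ₘ Γ) → CPrv C (.bang A ::ₘ Γ.map .quest)

/-- LLW: classical affine logic, with a set of non-logical axioms. -/
def LLWc (Φ : Set CForm) : CCalc :=
  ⟨fun _ => True, Φ, True, True, True, False, False⟩

/-- ELLW: classical elementary affine logic. -/
def ELLWc (Φ : Set CForm) : CCalc :=
  ⟨fun _ => True, Φ, True, False, False, True, False⟩

/-- InFLew: the {⊗,⅋,&,⊕,1,⊥}-fragment of LLW. -/
def InFLewc (Φ : Set CForm) : CCalc :=
  ⟨CForm.inMALL, Φ, True, False, False, False, False⟩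

/-- LL: classical linear logic (weakening restricted to ?W). -/
def LLc (Φ : Set CForm) : CCalc :=
  ⟨fun _ => True, Φ, False, True, True, False, True⟩

/-- The translation (·)^[F] of classical formulas into intuitionistic formulas,
where ¬_F B := B ⊸ F. -/
def trF (F : IForm) : CForm → IForm
  | .pos n => .limp (.var n) F
  | .neg n => .var n
  | .one => .limp .one F
  | .bot => .one
  | .top => .zero
  | .zero => .limp .zero F
  | .tensor B C => .limp (.limp (trF F B) F) (trF F C)
  | .par B C => .limp (.limp (trF F B) (.limp (trF F C) F)) F
  | .and B C => .or (trF F B) (trF F C)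
  | .or B C => .limp (.or (.limp (trF F B) F) (.limp (trF F C) F)) F
  | .bang B => .limp (.bang (.limp (trF F B) F)) F
  | .quest B => .bang (trF F B)

/-- The embedding (·)̲ of ⊥-free intuitionistic formulas into classical formulas. -/
def emb : IForm → CForm
  | .var n => .pos n
  | .one => .one
  | .top => .top
  | .bot => .bot
  | .zero => .zero
  | .tensor A B => .tensor (emb A) (emb B)
  | .limp A B => .par (emb A).dual (emb B)
  | .and A B => .and (emb A) (emb B)
  | .or A B => .or (emb A) (emb B)
  | .bang A => .bang (emb A)
  | .para A => .bang (emb A)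

end Affine

namespace Affine

theorem IPrv.weaken {Θ Δ : Multiset IForm} {X : Option IForm}
    (hΘ : ∀ A ∈ Θ, A.inFLei) (h : IPrv (FLewc ∅) Δ X) : IPrv (FLewc ∅) (Θ + Δ) X := by
  induction Θ using Multiset.induction with
  | empty => simpa using h
  | cons A Θ ih =>
    rw [Multiset.cons_add]
    exact .weakL trivial (hΘ A (by simp)) (ih fun B hB => hΘ B (by simp [hB]))

theorem forall_mem_nsmul_inFLei {Γ : Multiset IForm} (hΓ : ∀ A ∈ Γ, A.inFLei) (n : ℕ) :
    ∀ A ∈ n • Γ, A.inFLei :=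
  fun A hA => hΓ A (Multiset.mem_of_mem_nsmul hA)

/-- Provability in FLew from the hypotheses `Γ`, each usable any finite number of times. -/
def FLewFrom (Γ Δ : Multiset IForm) (X : Option IForm) : Prop :=
  ∃ n : ℕ, IPrv (FLewc ∅) (n • Γ + Δ) X

namespace FLewFrom

variable {Γ Δ Θ : Multiset IForm} {X : Option IForm} {A B : IForm}

theorem of_prv (h : IPrv (FLewc ∅) Δ X) : FLewFrom Γ Δ X := ⟨0, by simpa using h⟩

theorem map_cons (f : ∀ {Ξ}, IPrv (FLewc ∅) (A ::ₘ Ξ) X → IPrv (FLewc ∅) (B ::ₘ Ξ) X)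
    (h : FLewFrom Γ (A ::ₘ Δ) X) : FLewFrom Γ (B ::ₘ Δ) X := by
  obtain ⟨n, h⟩ := h
  exact ⟨n, by rw [Multiset.add_cons] at h ⊢; exact f h⟩

theorem cut (h : FLewFrom Γ Δ (some A)) (h' : FLewFrom Γ (A ::ₘ Θ) X) :
    FLewFrom Γ (Δ + Θ) X := by
  obtain ⟨n, h⟩ := h
  obtain ⟨m, h'⟩ := h'
  rw [Multiset.add_cons] at h'
  exact ⟨n + m, by rw [add_nsmul, add_add_add_comm]; exact h.cut h'⟩

theorem cut_nil (h : FLewFrom Γ 0 (some A)) (h' : FLewFrom Γ (A ::ₘ Δ) X) : FLewFrom Γ Δ X := by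
  simpa using h.cut h'

theorem limpL (hK : (IForm.limp A B).inFLei) (h : FLewFrom Γ Δ (some A))
    (h' : FLewFrom Γ (B ::ₘ Θ) X) : FLewFrom Γ (.limp A B ::ₘ (Δ + Θ)) X := by
  obtain ⟨n, h⟩ := h
  obtain ⟨m, h'⟩ := h'
  rw [Multiset.add_cons] at h'
  exact ⟨n + m, by
    rw [add_nsmul, Multiset.add_cons, add_add_add_comm]
    exact .limpL hK h h'⟩

theorem limpR (hK : (IForm.limp A B).inFLei) (h : FLewFrom Γ (A ::ₘ Δ) (some B)) :
    FLewFrom Γ Δ (some (.limp A B)) := by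
  obtain ⟨n, h⟩ := h
  rw [Multiset.add_cons] at h
  exact ⟨n, .limpR hK h⟩

theorem tensorL (hK : (IForm.tensor A B).inFLei) (h : FLewFrom Γ (A ::ₘ B ::ₘ Δ) X) :
    FLewFrom Γ (.tensor A B ::ₘ Δ) X := by
  obtain ⟨n, h⟩ := h
  rw [Multiset.add_cons, Multiset.add_cons] at h
  exact ⟨n, by rw [Multiset.add_cons]; exact .tensorL hK h⟩

theorem tensorR (hK : (IForm.tensor A B).inFLei) (h : FLewFrom Γ Δ (some A))
    (h' : FLewFrom Γ Θ (some B)) : FLewFrom Γ (Δ + Θ) (some (.tensor A B)) := by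
  obtain ⟨n, h⟩ := h
  obtain ⟨m, h'⟩ := h'
  exact ⟨n + m, by rw [add_nsmul, add_add_add_comm]; exact .tensorR hK h h'⟩

theorem weakL (hA : A.inFLei) (h : FLewFrom Γ Δ X) : FLewFrom Γ (A ::ₘ Δ) X := by
  obtain ⟨n, h⟩ := h
  exact ⟨n, by rw [Multiset.add_cons]; exact .weakL trivial hA h⟩

theorem common (hΓ : ∀ A ∈ Γ, A.inFLei) {Y : Option IForm}
    (h : FLewFrom Γ Δ X) (h' : FLewFrom Γ Θ Y) :
    ∃ n : ℕ, IPrv (FLewc ∅) (n • Γ + Δ) X ∧ IPrv (FLewc ∅) (n • Γ + Θ) Y := by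
  obtain ⟨n, h⟩ := h
  obtain ⟨m, h'⟩ := h'
  refine ⟨n + m, ?_, ?_⟩
  · rw [add_nsmul, add_comm (n • Γ), add_assoc]
    exact h.weaken (forall_mem_nsmul_inFLei hΓ m)
  · rw [add_nsmul, add_assoc]
    exact h'.weaken (forall_mem_nsmul_inFLei hΓ n)

theorem withR (hΓ : ∀ A ∈ Γ, A.inFLei) (hK : (IForm.and A B).inFLei)
    (h : FLewFrom Γ Δ (some A)) (h' : FLewFrom Γ Δ (some B)) :
    FLewFrom Γ Δ (some (.and A B)) := by
  obtain ⟨n, h, h'⟩ := common hΓ h h'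
  exact ⟨n, .withR hK h h'⟩

theorem plusL (hΓ : ∀ A ∈ Γ, A.inFLei) (hK : (IForm.or A B).inFLei)
    (h : FLewFrom Γ (A ::ₘ Δ) X) (h' : FLewFrom Γ (B ::ₘ Δ) X) :
    FLewFrom Γ (.or A B ::ₘ Δ) X := by
  obtain ⟨n, h, h'⟩ := common hΓ h h'
  rw [Multiset.add_cons] at h h'
  exact ⟨n, by rw [Multiset.add_cons]; exact .plusL hK h h'⟩

theorem one (hΔ : ∀ A ∈ Δ, A.inFLei) : FLewFrom Γ Δ (some .one) :=
  of_prv (by simpa using IPrv.weaken hΔ (.oneR (C := FLewc ∅) trivial))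

theorem bot (hΔ : ∀ A ∈ Δ, A.inFLei) (hX : ∀ A, X = some A → A.inFLei) :
    FLewFrom Γ (.bot ::ₘ Δ) X := by
  apply of_prv
  have h : IPrv (FLewc ∅) (.bot ::ₘ Δ) none := by
    rw [← Multiset.singleton_add, add_comm]
    exact IPrv.weaken hΔ (.botL trivial)
  cases X with
  | none => exact h
  | some A => exact .weakR trivial (hX A rfl) h

theorem of_mem (hΓ : ∀ A ∈ Γ, A.inFLei) (hA : A ∈ Γ) : FLewFrom Γ 0 (some A) := by
  obtain ⟨Ξ, rfl⟩ := Multiset.exists_cons_of_mem hA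
  refine ⟨1, ?_⟩
  rw [one_nsmul, add_zero, ← Multiset.singleton_add, add_comm]
  exact IPrv.weaken (fun B hB => hΓ B (Multiset.mem_cons_of_mem hB)) (.init (hΓ A hA))

theorem drop_ones (hΘ : ∀ A ∈ Θ, A = .one) (h : FLewFrom Γ (Θ + Δ) X) : FLewFrom Γ Δ X := by
  induction Θ using Multiset.induction with
  | empty => simpa using h
  | cons A Θ ih =>
    obtain rfl := hΘ A (by simp)
    rw [Multiset.cons_add] at h
    exact ih (fun B hB => hΘ B (by simp [hB])) (cut_nil (one (by simp)) h)

end FLewFrom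

open Classical in
/-- Interpretation of formulas in FLew over the hypotheses `Γ`: `!A` is `1` if the interpretation
of `A` is provable from `Γ`, and `⊥` otherwise. -/
noncomputable def collapse (Γ : Multiset IForm) : IForm → IForm
  | .var n => .var n
  | .one => .one
  | .top => .one
  | .bot => .bot
  | .zero => .bot
  | .tensor A B => .tensor (collapse Γ A) (collapse Γ B)
  | .limp A B => .limp (collapse Γ A) (collapse Γ B)
  | .and A B => .and (collapse Γ A) (collapse Γ B)
  | .or A B => .or (collapse Γ A) (collapse Γ B)
  | .bang A => if FLewFrom Γ 0 (some (collapse Γ A)) then .one else .bot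
  | .para _ => .one

section Collapse

variable {Γ : Multiset IForm}

theorem collapse_inFLei (A : IForm) : (collapse Γ A).inFLei := by
  induction A with
  | bang A => rw [collapse]; split_ifs <;> trivial
  | _ => simp_all [collapse, IForm.inFLei]

theorem collapse_of_inFLei {A : IForm} (hA : A.inFLei) : collapse Γ A = A := by
  induction A <;> simp_all [collapse, IForm.inFLei]

theorem collapse_bang_cases (Γ : Multiset IForm) (A : IForm) :
    FLewFrom Γ 0 (some (collapse Γ A)) ∧ collapse Γ (.bang A) = .one ∨
      collapse Γ (.bang A) = .bot := by
  by_cases h : FLewFrom Γ 0 (some (collapse Γ A)) <;> simp [collapse, h]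

theorem map_collapse_inFLei (Δ : Multiset IForm) : ∀ A ∈ Δ.map (collapse Γ), A.inFLei := by
  simp only [Multiset.mem_map]
  rintro _ ⟨A, -, rfl⟩
  exact collapse_inFLei A

theorem option_map_collapse_inFLei (X : Option IForm) :
    ∀ A, X.map (collapse Γ) = some A → A.inFLei := by
  simp only [Option.map_eq_some_iff]
  rintro _ ⟨A, -, rfl⟩
  exact collapse_inFLei A

theorem FLewFrom.collapse_bot (Δ : Multiset IForm) (X : Option IForm) :
    FLewFrom Γ (.bot ::ₘ Δ.map (collapse Γ)) (X.map (collapse Γ)) :=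
  .bot (map_collapse_inFLei Δ) (option_map_collapse_inFLei X)

theorem collapse_sound (hΓ : ∀ A ∈ Γ, A.inFLei) {Δ : Multiset IForm} {X : Option IForm}
    (h : IPrv (ILZWpc ∅) Δ X) : FLewFrom Γ (Δ.map (collapse Γ)) (X.map (collapse Γ)) := by
  have hK := collapse_inFLei (Γ := Γ)
  induction h with
  | axiom' h => exact h.elim
  | init => exact .of_prv (by simpa using .init (hK _))
  | oneR => exact .one (by simp)
  | botL => exact .of_prv (by simpa [collapse] using .botL trivial)
  | topR => exact .one (map_collapse_inFLei _)
  | zeroL => rw [Multiset.map_cons]; exact .collapse_bot _ _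
  | cut _ _ ih ih' =>
    rw [Multiset.map_cons] at ih'
    rw [Multiset.map_add]
    exact ih.cut ih'
  | oneL _ _ ih => rw [Multiset.map_cons]; exact ih.weakL trivial
  | botR _ _ ih =>
    obtain ⟨n, ih⟩ := ih
    exact ⟨n, .botR trivial ih⟩
  | limpL _ _ _ ih ih' =>
    rw [Multiset.map_cons] at ih'
    rw [Multiset.map_cons, Multiset.map_add]
    exact .limpL (hK (.limp _ _)) ih ih'
  | limpR _ _ ih =>
    rw [Multiset.map_cons] at ih
    exact .limpR (hK (.limp _ _)) ih
  | tensorL _ _ ih =>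
    rw [Multiset.map_cons, Multiset.map_cons] at ih
    rw [Multiset.map_cons]
    exact .tensorL (hK (.tensor _ _)) ih
  | tensorR _ _ _ ih ih' =>
    rw [Multiset.map_add]
    exact .tensorR (hK (.tensor _ _)) ih ih'
  | withL1 _ _ ih =>
    rw [Multiset.map_cons] at ih ⊢
    exact ih.map_cons (.withL1 (hK (.and _ _)))
  | withL2 _ _ ih =>
    rw [Multiset.map_cons] at ih ⊢
    exact ih.map_cons (.withL2 (hK (.and _ _)))
  | withR _ _ _ ih ih' => exact .withR hΓ (hK (.and _ _)) ih ih'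
  | plusL _ _ _ ih ih' =>
    rw [Multiset.map_cons] at ih ih' ⊢
    exact .plusL hΓ (hK (.or _ _)) ih ih'
  | plusR1 _ _ ih =>
    obtain ⟨n, ih⟩ := ih
    exact ⟨n, .plusR1 (hK (.or _ _)) ih⟩
  | plusR2 _ _ ih =>
    obtain ⟨n, ih⟩ := ih
    exact ⟨n, .plusR2 (hK (.or _ _)) ih⟩
  | @bangD _ _ A _ _ _ ih =>
    rw [Multiset.map_cons] at ih ⊢
    rcases collapse_bang_cases Γ A with ⟨h, e⟩ | e <;> rw [e]
    · exact (h.cut_nil ih).weakL trivial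
    · exact .collapse_bot _ _
  | @bangP Ξ A _ _ _ _ ih =>
    by_cases hΞ : ∀ B ∈ (Ξ.map IForm.bang).map (collapse Γ), B = .one
    · have hA : FLewFrom Γ 0 (some (collapse Γ A)) :=
        .drop_ones hΞ (by simpa using ih)
      have e : collapse Γ (.bang A) = .one := by simp [collapse, hA]
      rw [Option.map_some, e]
      exact .one (map_collapse_inFLei _)
    · push Not at hΞ
      simp only [Multiset.map_map, Multiset.mem_map, Function.comp_apply] at hΞ
      obtain ⟨_, ⟨B, hB, rfl⟩, hne⟩ := hΞ
      have e := (collapse_bang_cases Γ B).resolve_left fun h => hne h.2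
      obtain ⟨Ξ, rfl⟩ := Multiset.exists_cons_of_mem hB
      rw [Multiset.map_cons, Multiset.map_cons, e]
      exact .collapse_bot _ _
  | weakL _ _ _ ih => rw [Multiset.map_cons]; exact ih.weakL (hK _)
  | @bangC _ _ A _ _ ih =>
    rw [Multiset.map_cons, Multiset.map_cons] at ih
    rw [Multiset.map_cons]
    rcases collapse_bang_cases Γ A with ⟨_, e⟩ | e <;> rw [e] at ih ⊢
    · exact .cut_nil (.one (by simp)) ih
    · exact .collapse_bot _ _
  | weakR _ _ _ ih =>
    obtain ⟨n, ih⟩ := ih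
    exact ⟨n, .weakR trivial (hK _) ih⟩
  | bangF h => exact h.elim
  | bangW h => exact h.elim
  | lalBang h => exact h.elim
  | lalPara h => exact h.elim

end Collapse

/-- If the !-prenex {⊗,⊸,&,⊕,1,⊥}-sequent `!Γ,Δ ⊢ X` is provable in ILZW',
then `Γ^n,Δ ⊢ X` is provable in FLew for some `n ≥ 0`. -/
theorem ilzwp_prenex_to_flew (Γ Δ : Multiset IForm) (X : Option IForm)
    (hΓ : ∀ A ∈ Γ, A.inFLei) (hΔ : ∀ A ∈ Δ, A.inFLei)
    (hX : ∀ A, X = some A → A.inFLei)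
    (h : IPrv (ILZWpc ∅) (Γ.map IForm.bang + Δ) X) :
    ∃ n : ℕ, IPrv (FLewc ∅) (n • Γ + Δ) X := by
  have hs := collapse_sound hΓ h
  have eΔ : Δ.map (collapse Γ) = Δ := by
    conv_rhs => rw [← Multiset.map_id Δ]
    exact Multiset.map_congr rfl fun A hA => collapse_of_inFLei (hΔ A hA)
  have eX : X.map (collapse Γ) = X := by
    cases X with
    | none => rfl
    | some A => rw [Option.map_some, collapse_of_inFLei (hX A rfl)]
  rw [Multiset.map_add, eΔ, eX] at hs
  refine FLewFrom.drop_ones ?_ hs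
  simp only [Multiset.map_map, Multiset.mem_map, Function.comp_apply]
  rintro _ ⟨A, hA, rfl⟩
  have hA' : FLewFrom Γ 0 (some (collapse Γ A)) := by
    rw [collapse_of_inFLei (hΓ A hA)]
    exact .of_mem hΓ hA
  simp [collapse, hA']

end Affine
end

section
/- Let ⊢ ?Γ,Δ be a ?-prenex {⊗,⅋,&,⊕,1,⊥}-sequent. If ⊢ ?Γ,Δ is provable in LLW, then there exists n ≥ 0 such that ⊢ Γ^n,Δ is provable in InFLew. -/
namespace Affine

open scoped Pointwise

/-- The orthogonal of `X` in the phase space of multisets of formulas with pole `P`. -/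
def orth (P X : Set (Multiset CForm)) : Set (Multiset CForm) :=
  {m | ∀ x ∈ X, m + x ∈ P}

section Orth

variable {P X Y : Set (Multiset CForm)}

theorem orth_anti (h : X ⊆ Y) : orth P Y ⊆ orth P X := fun _ hm x hx => hm x (h hx)

theorem subset_orth_orth : X ⊆ orth P (orth P X) := fun x hx m hm => by
  rw [add_comm]
  exact hm x hx

theorem orth_orth_orth : orth P (orth P (orth P X)) = orth P X :=
  (orth_anti subset_orth_orth).antisymm subset_orth_orth

theorem orth_inter_orth :
    orth P (orth P (orth P X ∩ orth P Y)) = orth P X ∩ orth P Y := by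
  refine Set.Subset.antisymm (Set.subset_inter ?_ ?_) subset_orth_orth
  · exact (orth_anti (orth_anti Set.inter_subset_left)).trans orth_orth_orth.subset
  · exact (orth_anti (orth_anti Set.inter_subset_right)).trans orth_orth_orth.subset

end Orth

/-- The refutation semantics of classical formulas in the phase space with pole `P`: the
orthogonal of the fact denoted by a formula. The exponentials are two-valued. -/
def refut (P : Set (Multiset CForm)) : CForm → Set (Multiset CForm)
  | .pos n => orth P (orth P {{.pos n}})
  | .neg n => orth P {{.pos n}}
  | .one => orth P Set.univ
  | .bot => orth P (orth P Set.univ)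
  | .top => orth P Set.univ
  | .zero => orth P (orth P Set.univ)
  | .tensor A B => orth P (orth P (refut P A) + orth P (refut P B))
  | .par A B => orth P (orth P (refut P A + refut P B))
  | .and A B => orth P (orth P (refut P A) ∩ orth P (refut P B))
  | .or A B => refut P A ∩ refut P B
  | .bang A => orth P {m | m = 0 ∧ 0 ∈ orth P (refut P A)}
  | .quest A => orth P (orth P {m | m = 0 ∧ 0 ∈ refut P A})

section Soundness

variable {P : Set (Multiset CForm)}

theorem orth_orth_refut (A : CForm) : orth P (orth P (refut P A)) = refut P A := by
  induction A with
  | or A B ihA ihB => rw [refut, ← ihA, ← ihB, orth_inter_orth]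
  | _ => simp only [refut, orth_orth_orth]

theorem refut_dual (A : CForm) : refut P A.dual = orth P (refut P A) := by
  induction A with
  | or A B ihA ihB => simp only [CForm.dual, refut, ihA, ihB, orth_orth_refut]
  | and A B ihA ihB => simp only [CForm.dual, refut, ihA, ihB, orth_inter_orth]
  | tensor A B ihA ihB => simp only [CForm.dual, refut, ihA, ihB]
  | par A B ihA ihB => simp only [CForm.dual, refut, ihA, ihB, orth_orth_refut, orth_orth_orth]
  | bang A ih => simp only [CForm.dual, refut, ih]
  | quest A ih => simp only [CForm.dual, refut, ih, orth_orth_refut, orth_orth_orth]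
  | _ => simp only [CForm.dual, refut, orth_orth_orth]

/-- The set of refutations of a sequent. -/
def refutSeq (P : Set (Multiset CForm)) (Γ : Multiset CForm) : Set (Multiset CForm) :=
  (Γ.map (refut P)).sum

theorem refutSeq_zero : refutSeq P 0 = 0 := by simp [refutSeq]

theorem refutSeq_cons (A : CForm) (Γ : Multiset CForm) :
    refutSeq P (A ::ₘ Γ) = refut P A + refutSeq P Γ := by simp [refutSeq]

theorem refutSeq_add (Γ Δ : Multiset CForm) :
    refutSeq P (Γ + Δ) = refutSeq P Γ + refutSeq P Δ := by simp [refutSeq]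

theorem add_subset_iff_subset_orth {X Y : Set (Multiset CForm)} :
    X + Y ⊆ P ↔ Y ⊆ orth P X := by
  rw [Set.add_subset_iff]
  exact ⟨fun h y hy x hx => add_comm x y ▸ h x hx y hy,
    fun h x hx y hy => add_comm y x ▸ h hy x hx⟩

theorem refutSeq_cons_subset {A : CForm} {Γ : Multiset CForm} :
    refutSeq P (A ::ₘ Γ) ⊆ P ↔ refutSeq P Γ ⊆ orth P (refut P A) := by
  rw [refutSeq_cons, add_subset_iff_subset_orth]

theorem zero_mem_refutSeq {Γ : Multiset CForm} (h : ∀ A ∈ Γ, 0 ∈ refut P A) :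
    0 ∈ refutSeq P Γ := by
  induction Γ using Multiset.induction_on with
  | empty => simp [refutSeq_zero]
  | cons A Γ ih =>
    rw [refutSeq_cons]
    exact Set.mem_add.2 ⟨0, h A (by simp), 0, ih fun B hB => h B (by simp [hB]), by simp⟩

theorem self_mem_refutSeq {Γ : Multiset CForm} (h : ∀ A ∈ Γ, {A} ∈ refut P A) :
    Γ ∈ refutSeq P Γ := by
  induction Γ using Multiset.induction_on with
  | empty => simp [refutSeq_zero]
  | cons A Γ ih =>
    rw [refutSeq_cons]
    exact Set.mem_add.2 ⟨{A}, h A (by simp), Γ, ih fun B hB => h B (by simp [hB]), by simp⟩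

theorem zero_mem_refut_quest {A : CForm} (h : 0 ∈ refut P A) : 0 ∈ refut P (.quest A) :=
  subset_orth_orth ⟨rfl, h⟩

theorem orth_refut_quest (A : CForm) :
    orth P (refut P (.quest A)) = {m | 0 ∈ refut P A → m ∈ P} := by
  rw [refut, orth_orth_orth]
  ext m
  constructor
  · intro h hA
    simpa using h 0 ⟨rfl, hA⟩
  · rintro h _ ⟨rfl, hA⟩
    simpa using h hA

/-- The refutations of a sequent `?Γ` are trivial unless `0` refutes every member of `Γ`. -/
theorem refutSeq_map_quest_subset (hP : ∀ m ∈ P, ∀ x, x + m ∈ P) {Γ : Multiset CForm}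
    {B : CForm} (hB : B ∈ Γ) (h : 0 ∉ refut P B) :
    refutSeq P (Γ.map .quest) ⊆ orth P Set.univ := by
  obtain ⟨Δ, rfl⟩ := Multiset.exists_cons_of_mem hB
  rw [Multiset.map_cons, refutSeq_cons]
  intro s hs m _
  obtain ⟨x, hx, y, -, rfl⟩ := Set.mem_add.1 hs
  have hx' : x + m ∈ P := hx m (by rintro _ ⟨-, h0⟩; exact (h h0).elim)
  convert hP _ hx' y using 1
  abel

/-- Soundness of LLW for phase spaces whose pole is closed under weakening. -/
theorem CPrv.refutSeq_subset (hP : ∀ m ∈ P, ∀ x, x + m ∈ P) {Θ : Multiset CForm}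
    (h : CPrv (LLWc ∅) Θ) : refutSeq P Θ ⊆ P := by
  induction h with
  | axiom' h => exact h.elim
  | init =>
    rw [Multiset.insert_eq_cons, refutSeq_cons_subset, ← refut_dual]
    simp [refutSeq]
  | one =>
    rw [← Multiset.cons_zero, refutSeq_cons_subset, refutSeq_zero]
    exact Set.zero_subset.2 fun m hm => by simpa [add_comm] using hm 0 trivial
  | top =>
    rw [refutSeq_cons_subset]
    exact (Set.subset_univ _).trans subset_orth_orth
  | cut _ _ ih₁ ih₂ =>
    rw [refutSeq_cons_subset] at ih₁ ih₂
    rw [refut_dual] at ih₂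
    rw [refutSeq_add, add_subset_iff_subset_orth]
    exact ih₂.trans (orth_anti ih₁)
  | bot _ _ ih =>
    rw [refutSeq_cons, Set.add_subset_iff]
    exact fun x _ y hy => hP y (ih hy) x
  | tensor _ _ _ ih₁ ih₂ =>
    rw [refutSeq_cons_subset] at ih₁ ih₂ ⊢
    rw [refutSeq_add]
    exact (Set.add_subset_add ih₁ ih₂).trans subset_orth_orth
  | par _ _ ih =>
    rw [refutSeq_cons, refutSeq_cons, ← add_assoc, add_subset_iff_subset_orth] at ih
    rw [refutSeq_cons_subset, refut, orth_orth_orth]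
    exact ih
  | with' _ _ _ ih₁ ih₂ =>
    rw [refutSeq_cons_subset] at ih₁ ih₂ ⊢
    exact (Set.subset_inter ih₁ ih₂).trans subset_orth_orth
  | plus1 _ _ ih =>
    rw [refutSeq_cons_subset] at ih ⊢
    exact ih.trans (orth_anti Set.inter_subset_left)
  | plus2 _ _ ih =>
    rw [refutSeq_cons_subset] at ih ⊢
    exact ih.trans (orth_anti Set.inter_subset_right)
  | der _ _ _ ih =>
    rw [refutSeq_cons_subset] at ih ⊢
    rw [orth_refut_quest]
    intro s hs hA
    simpa using ih hs 0 hA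
  | @prom Γ A _ _ _ _ ih =>
    rw [refutSeq_cons_subset] at ih ⊢
    by_cases hΓ : ∀ B ∈ Γ, 0 ∈ refut P B
    · have h0 : 0 ∈ orth P (refut P A) := ih (zero_mem_refutSeq (by
        simpa using fun B hB => zero_mem_refut_quest (hΓ B hB)))
      intro s _ m hm
      exact hP m (by simpa using hm 0 ⟨rfl, h0⟩) s
    · push Not at hΓ
      obtain ⟨B, hB, h⟩ := hΓ
      exact (refutSeq_map_quest_subset hP hB h).trans (orth_anti (Set.subset_univ _))
  | wk _ _ _ ih =>
    rw [refutSeq_cons, Set.add_subset_iff]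
    exact fun x _ y hy => hP y (ih hy) x
  | questW h => exact h.elim
  | questC _ _ ih =>
    rw [refutSeq_cons_subset, refutSeq_cons] at ih
    rw [refutSeq_cons_subset, orth_refut_quest]
    intro s hs hA
    have h0 := zero_mem_refut_quest hA
    simpa using ih (Set.add_mem_add h0 hs) 0 h0
  | funcF h => exact h.elim

end Soundness

theorem CPrv.weaken {Γ Δ : Multiset CForm} (hΔ : ∀ A ∈ Δ, A.inMALL)
    (h : CPrv (InFLewc ∅) Γ) : CPrv (InFLewc ∅) (Δ + Γ) := by
  induction Δ using Multiset.induction_on with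
  | empty => simpa using h
  | cons A Δ ih =>
    rw [Multiset.cons_add]
    exact .wk trivial (hΔ A (by simp)) (ih fun B hB => hΔ B (by simp [hB]))

/-- The pole of multisets provable in InFLew from copies of `Γ`. Multisets outside the
language of InFLew are included by convention. -/
def prenexPole (Γ : Multiset CForm) : Set (Multiset CForm) :=
  {m | (∀ A ∈ m, A.inMALL) → ∃ n : ℕ, CPrv (InFLewc ∅) (n • Γ + m)}

section Pole

variable {Γ : Multiset CForm}

theorem add_mem_prenexPole (m : Multiset CForm) (hm : m ∈ prenexPole Γ)
    (x : Multiset CForm) : x + m ∈ prenexPole Γ := by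
  intro h
  obtain ⟨n, hn⟩ := hm fun A hA => h A (by simp [hA])
  refine ⟨n, ?_⟩
  rw [add_left_comm]
  exact hn.weaken fun A hA => h A (by simp [hA])

/-- Every formula of InFLew refutes itself. -/
theorem singleton_mem_refut (hΓ : ∀ A ∈ Γ, A.inMALL) {A : CForm} (hA : A.inMALL) :
    {A} ∈ refut (prenexPole Γ) A := by
  have mall_of_add {x : Multiset CForm} {B C : CForm} (hC : C.inMALL)
      (h : ∀ A ∈ x + {B}, A.inMALL) : ∀ A ∈ x + {C}, A.inMALL := by
    intro D hD
    rcases Multiset.mem_add.1 hD with hD | hD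
    · exact h D (by simp [hD])
    · rwa [Multiset.mem_singleton.1 hD]
  induction A with
  | pos n => exact subset_orth_orth rfl
  | neg n =>
    rintro _ rfl _
    refine ⟨0, ?_⟩
    rw [zero_nsmul, zero_add]
    exact .init (C := InFLewc ∅) (A := .neg n) trivial trivial
  | one =>
    intro x _ h
    refine ⟨0, ?_⟩
    rw [zero_nsmul, zero_add, add_comm]
    exact (CPrv.one (C := InFLewc ∅) trivial).weaken fun A hA => h A (by simp [hA])
  | bot => exact subset_orth_orth trivial
  | tensor A B ihA ihB =>
    intro z hz h
    obtain ⟨x, hx, y, hy, rfl⟩ := Set.mem_add.1 hz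
    obtain ⟨k, hk⟩ := hx _ (ihA hA.1) (mall_of_add hA.1 (B := .tensor A B)
      fun C hC => h C (by simp at hC ⊢; tauto))
    obtain ⟨l, hl⟩ := hy _ (ihB hA.2) (mall_of_add hA.2 (B := .tensor A B)
      fun C hC => h C (by simp at hC ⊢; tauto))
    refine ⟨k + l, ?_⟩
    have := CPrv.tensor (C := InFLewc ∅) (Γ := k • Γ + x) (Δ := l • Γ + y) (A := A) (B := B) hA
      (by convert hk using 1; rw [← Multiset.singleton_add]; abel)
      (by convert hl using 1; rw [← Multiset.singleton_add]; abel)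
    convert this using 1
    rw [← Multiset.singleton_add, add_nsmul]
    abel
  | par A B ihA ihB =>
    intro x hx h
    obtain ⟨k, hk⟩ := hx _ (Set.add_mem_add (ihA hA.1) (ihB hA.2)) (by
      intro C hC
      simp only [Multiset.mem_add, Multiset.mem_singleton] at hC
      rcases hC with hC | rfl | rfl
      exacts [h C (by simp [hC]), hA.1, hA.2])
    refine ⟨k, ?_⟩
    have := CPrv.par (C := InFLewc ∅) (Γ := k • Γ + x) (A := A) (B := B) hA
      (by convert hk using 1; simp only [← Multiset.singleton_add]; abel)
    convert this using 1
    rw [← Multiset.singleton_add]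
    abel
  | and A B ihA ihB =>
    rintro x ⟨hxA, hxB⟩ h
    rw [add_comm] at h
    obtain ⟨k, hk⟩ := hxA _ (ihA hA.1) (mall_of_add hA.1 h)
    obtain ⟨l, hl⟩ := hxB _ (ihB hA.2) (mall_of_add hA.2 h)
    have hΓn (n : ℕ) : ∀ A ∈ n • Γ, A.inMALL := fun A h => hΓ A (Multiset.mem_of_mem_nsmul h)
    refine ⟨k + l, ?_⟩
    have := CPrv.with' (C := InFLewc ∅) (Γ := (k + l) • Γ + x) (A := A) (B := B) hA
      (by convert hk.weaken (hΓn l) using 1; rw [← Multiset.singleton_add, add_nsmul]; abel)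
      (by convert hl.weaken (hΓn k) using 1; rw [← Multiset.singleton_add, add_nsmul]; abel)
    convert this using 1
    rw [← Multiset.singleton_add]
    abel
  | or A B ihA ihB =>
    constructor
    · rw [← orth_orth_refut]
      intro x hx h
      rw [add_comm] at h
      obtain ⟨k, hk⟩ := hx _ (ihA hA.1) (mall_of_add hA.1 h)
      refine ⟨k, ?_⟩
      have := CPrv.plus1 (C := InFLewc ∅) (Γ := k • Γ + x) (A := A) (B := B) hA
        (by convert hk using 1; rw [← Multiset.singleton_add]; abel)
      convert this using 1
      rw [← Multiset.singleton_add]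
      abel
    · rw [← orth_orth_refut]
      intro x hx h
      rw [add_comm] at h
      obtain ⟨k, hk⟩ := hx _ (ihB hA.2) (mall_of_add hA.2 h)
      refine ⟨k, ?_⟩
      have := CPrv.plus2 (C := InFLewc ∅) (Γ := k • Γ + x) (A := A) (B := B) hA
        (by convert hk using 1; rw [← Multiset.singleton_add]; abel)
      convert this using 1
      rw [← Multiset.singleton_add]
      abel
  | _ => exact hA.elim

theorem zero_mem_refut (hΓ : ∀ A ∈ Γ, A.inMALL) {A : CForm} (hA : A ∈ Γ) :
    0 ∈ refut (prenexPole Γ) A := by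
  rw [← orth_orth_refut]
  intro x hx h
  rw [zero_add] at h
  obtain ⟨n, hn⟩ := hx _ (singleton_mem_refut hΓ (hΓ A hA)) (by
    intro B hB
    rcases Multiset.mem_add.1 hB with hB | hB
    · exact h B (by simpa using hB)
    · exact Multiset.mem_singleton.1 hB ▸ hΓ A hA)
  obtain ⟨Δ, rfl⟩ := Multiset.exists_cons_of_mem hA
  refine ⟨n + 1, ?_⟩
  convert hn.weaken (Δ := Δ) (fun B hB => hΓ B (by simp [hB])) using 1
  simp only [← Multiset.singleton_add, add_nsmul, one_nsmul]
  abel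

end Pole

/-- If the ?-prenex {⊗,⅋,&,⊕,1,⊥}-sequent `⊢ ?Γ,Δ` is provable in LLW,
then `⊢ Γ^n,Δ` is provable in InFLew for some `n ≥ 0`. -/
theorem llw_prenex_to_inflew (Γ Δ : Multiset CForm)
    (hΓ : ∀ A ∈ Γ, A.inMALL) (hΔ : ∀ A ∈ Δ, A.inMALL)
    (h : CPrv (LLWc ∅) (Γ.map CForm.quest + Δ)) :
    ∃ n : ℕ, CPrv (InFLewc ∅) (n • Γ + Δ) := by
  have hsub := h.refutSeq_subset (P := prenexPole Γ) add_mem_prenexPole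
  have hquest : 0 ∈ refutSeq (prenexPole Γ) (Γ.map .quest) := zero_mem_refutSeq (by
    simpa using fun A hA => zero_mem_refut_quest (zero_mem_refut hΓ hA))
  have hmem := self_mem_refutSeq fun A hA => singleton_mem_refut hΓ (hΔ A hA)
  rw [refutSeq_add] at hsub
  exact hsub (by simpa using Set.add_mem_add hquest hmem) hΔ

end Affine
end

section
/- Let Φ be a finite set of intuitionistic {⊗,⊸,&,⊕,1,⊥}-formulas and Γ ⊢ Π an intuitionistic {⊗,⊸,&,⊕,1,⊥}-sequent. Then Γ ⊢ Π is provable in FLei[Φ] if and only if !Φ,Γ ⊢ Π is provable in ILZW, where !Φ is the multiset containing !B once for each B ∈ Φ. -/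
namespace Affine

open scoped Pointwise

theorem IForm.inFLei.inL : ∀ {A : IForm}, A.inFLei → A.inL
  | .var _, _ | .one, _ | .bot, _ => trivial
  | .tensor _ _, h | .limp _ _, h | .and _ _, h | .or _ _, h => ⟨h.1.inL, h.2.inL⟩

namespace IPrv

/-! ### Admissible rules -/

theorem weakL_add {C : ICalc} (hw : C.wL) {Γ : Multiset IForm} {X : Option IForm}
    (h : IPrv C Γ X) (Δ : Multiset IForm) (hΔ : ∀ A ∈ Δ, C.K A) : IPrv C (Δ + Γ) X := by
  induction Δ using Multiset.induction_on with
  | empty => simpa using h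
  | cons A Δ ih =>
    rw [Multiset.cons_add]
    exact weakL hw (hΔ A (by simp)) (ih fun B hB => hΔ B (by simp [hB]))

theorem contract_map_bang {C : ICalc} {X : Option IForm} (Ψ : Multiset IForm)
    (hΨ : ∀ B ∈ Ψ, C.K (.bang B)) {Γ : Multiset IForm}
    (h : IPrv C (Ψ.map .bang + (Ψ.map .bang + Γ)) X) : IPrv C (Ψ.map .bang + Γ) X := by
  induction Ψ using Multiset.induction_on generalizing Γ with
  | empty => simpa using h
  | cons B Ψ ih =>
    rw [Multiset.map_cons, Multiset.cons_add]
    refine bangC (hΨ B (by simp)) ?_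
    rw [← Multiset.add_cons, ← Multiset.add_cons]
    refine ih (fun A hA => hΨ A (by simp [hA])) ?_
    simpa only [Multiset.map_cons, Multiset.cons_add, Multiset.add_cons] using h

/-- Non-logical axioms can be traded for `!`-formulas in the antecedent. -/
theorem ilzw_of_flei {Φ : Finset IForm} (hΦ : ∀ B ∈ Φ, B.inFLei) {Γ : Multiset IForm}
    {X : Option IForm} (h : IPrv (FLeic ↑Φ) Γ X) :
    IPrv (ILZWc ∅) (Φ.val.map .bang + Γ) X := by
  have hK : ∀ B ∈ Φ.val, (ILZWc ∅).K (.bang B) := fun B hB => (hΦ B hB).inL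
  have hK' : ∀ A ∈ Φ.val.map IForm.bang, (ILZWc ∅).K A := by
    intro A hA
    obtain ⟨B, hB, rfl⟩ := Multiset.mem_map.1 hA
    exact hK B hB
  have weak {Γ X} (h : IPrv (ILZWc ∅) Γ X) : IPrv (ILZWc ∅) (Φ.val.map .bang + Γ) X :=
    weakL_add trivial h _ hK'
  induction h with
  | @axiom' B hB =>
    obtain ⟨Ψ, hΨ⟩ := Multiset.exists_cons_of_mem (show B ∈ Φ.val from hB)
    rw [hΨ] at hK' ⊢
    have hd : IPrv (ILZWc ∅) {.bang B} (some B) :=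
      bangD trivial (hΦ B hB).inL (init (hΦ B hB).inL)
    have := weakL_add trivial hd (Ψ.map .bang) fun A hA => hK' A (by simp [hA])
    rwa [Multiset.add_comm, Multiset.singleton_add, ← Multiset.map_cons,
      ← Multiset.add_zero (Multiset.map _ _)] at this
  | init h => exact weak (init h.inL)
  | oneR => exact weak (oneR trivial)
  | botL => exact weak (botL trivial)
  | topR h => exact h.elim
  | zeroL h => exact h.elim
  | cut _ _ ih₁ ih₂ =>
    refine contract_map_bang _ hK ?_
    rw [Multiset.add_cons] at ih₂
    convert cut ih₁ ih₂ using 1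
    ac_rfl
  | oneL _ _ ih =>
    rw [Multiset.add_cons]
    exact oneL trivial ih
  | botR _ _ ih => exact botR trivial ih
  | limpL h _ _ ih₁ ih₂ =>
    refine contract_map_bang _ hK ?_
    rw [Multiset.add_cons] at ih₂
    convert limpL h.inL ih₁ ih₂ using 1
    rw [Multiset.add_cons, Multiset.add_cons]
    congr 1
    ac_rfl
  | limpR h _ ih =>
    rw [Multiset.add_cons] at ih
    exact limpR h.inL ih
  | tensorL h _ ih =>
    rw [Multiset.add_cons, Multiset.add_cons] at ih
    rw [Multiset.add_cons]
    exact tensorL h.inL ih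
  | tensorR h _ _ ih₁ ih₂ =>
    refine contract_map_bang _ hK ?_
    convert tensorR h.inL ih₁ ih₂ using 1
    ac_rfl
  | withL1 h _ ih =>
    rw [Multiset.add_cons] at ih ⊢
    exact withL1 h.inL ih
  | withL2 h _ ih =>
    rw [Multiset.add_cons] at ih ⊢
    exact withL2 h.inL ih
  | withR h _ _ ih₁ ih₂ => exact withR h.inL ih₁ ih₂
  | plusL h _ _ ih₁ ih₂ =>
    rw [Multiset.add_cons] at ih₁ ih₂ ⊢
    exact plusL h.inL ih₁ ih₂
  | plusR1 h _ ih => exact plusR1 h.inL ih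
  | plusR2 h _ ih => exact plusR2 h.inL ih
  | bangD _ h => exact h.elim
  | bangP _ h => exact h.elim
  | bangF h => exact h.elim
  | weakL _ h _ ih =>
    rw [Multiset.add_cons]
    exact weakL trivial h.inL ih
  | bangW h => exact h.elim
  | bangC h => exact h.elim
  | weakR h => exact h.elim
  | lalBang h => exact h.elim
  | lalPara h => exact h.elim

end IPrv

/-! ### Phase semantics

Formulas are interpreted as closed subsets of a commutative monoid `M`, where the closure is
generated by a family `D : M → Option IForm → Prop` of predicates and their translates. -/

namespace Phase

variable {M : Type*} [AddCommMonoid M] (D : M → Option IForm → Prop)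

/-- The closure operator generated by the translates of the predicates `D · Y`. -/
def cl (S : Set M) : Set M :=
  {m | ∀ d Y, (∀ s ∈ S, D (s + d) Y) → D (m + d) Y}

/-- The interpretation of formulas; `!A` is everything if `A` is valid, and the least closed
set otherwise. -/
def interp : IForm → Set M
  | .var n => {m | D m (some (.var n))}
  | .one => Set.univ
  | .top => Set.univ
  | .bot => {m | D m none}
  | .zero => cl D ∅
  | .tensor A B => cl D (interp A + interp B)
  | .limp A B => {m | ∀ a ∈ interp A, m + a ∈ interp B}
  | .and A B => interp A ∩ interp B
  | .or A B => cl D (interp A ∪ interp B)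
  | .bang A => {m | 0 ∈ interp A ∨ m ∈ cl D ∅}
  | .para _ => Set.univ

/-- The interpretation of stoups. -/
def interpStoup (X : Option IForm) : Set M :=
  X.elim (interp D .bot) (interp D)

/-- The interpretation of antecedents. -/
def interpCtx (Γ : Multiset IForm) : Set M :=
  (Γ.map (interp D)).sum

variable {D}

theorem subset_cl (S : Set M) : S ⊆ cl D S := fun _ hm _ _ h => h _ hm

/-- A closed set absorbing the translate of `S` by `g` absorbs that of its closure. -/
theorem add_mem_of_mem_cl {S T : Set M} (hT : cl D T ⊆ T) {g t : M} (ht : t ∈ cl D S)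
    (h : ∀ s ∈ S, s + g ∈ T) : t + g ∈ T :=
  hT fun d Y hY => by
    rw [add_assoc]
    refine ht _ _ fun s hs => ?_
    rw [← add_assoc]
    exact hY _ (h s hs)

theorem cl_subset {S T : Set M} (hT : cl D T ⊆ T) (h : S ⊆ T) : cl D S ⊆ T := fun t ht => by
  simpa using add_mem_of_mem_cl (g := 0) hT ht fun s hs => by simpa using h hs

theorem cl_cl (S : Set M) : cl D (cl D S) ⊆ cl D S :=
  fun _ hm d Y hY => hm d Y fun _ hs => hs d Y hY

theorem cl_setOf_subset (Y : Option IForm) : cl D {m | D m Y} ⊆ {m | D m Y} := fun m hm => by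
  simpa using hm 0 Y fun s hs => by simpa using hs

theorem cl_interp_subset (A : IForm) : cl D (interp D A) ⊆ interp D A := by
  induction A with
  | var | bot => exact cl_setOf_subset _
  | one | top | para => exact Set.subset_univ _
  | zero | tensor | or => exact cl_cl _
  | limp A B _ ihB => exact fun m hm a ha => add_mem_of_mem_cl ihB hm fun s hs => hs a ha
  | and A B ihA ihB =>
    exact fun m hm => ⟨ihA fun d Y h => hm d Y fun s hs => h s hs.1,
      ihB fun d Y h => hm d Y fun s hs => h s hs.2⟩
  | bang A =>
    intro m hm
    by_cases h : (0 : M) ∈ interp D A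
    · exact Or.inl h
    · exact Or.inr (cl_subset (cl_cl _) (fun s hs => hs.resolve_left h) hm)

theorem cl_interpStoup_subset : ∀ X, cl D (interpStoup D X) ⊆ interpStoup D X
  | none => cl_interp_subset .bot
  | some A => cl_interp_subset A

theorem cl_empty_subset {T : Set M} (hT : cl D T ⊆ T) : cl D ∅ ⊆ T :=
  cl_subset hT (Set.empty_subset _)

theorem add_mem_cl_empty {m : M} (hm : m ∈ cl D ∅) (g : M) : m + g ∈ cl D ∅ :=
  add_mem_of_mem_cl (cl_cl _) hm fun _ hs => hs.elim

theorem add_mem_of_closed (hD : ∀ n m Y, D m Y → D (n + m) Y) {T : Set M} (hT : cl D T ⊆ T)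
    (n : M) {m : M} (hm : m ∈ T) : n + m ∈ T :=
  hT fun d Y h => by
    rw [add_assoc]
    exact hD _ _ _ (h m hm)

theorem interpCtx_cons (A : IForm) (Γ : Multiset IForm) :
    interpCtx D (A ::ₘ Γ) = interp D A + interpCtx D Γ := by
  simp [interpCtx]

theorem interpCtx_add (Γ Δ : Multiset IForm) :
    interpCtx D (Γ + Δ) = interpCtx D Γ + interpCtx D Δ := by
  simp [interpCtx]

theorem add_mem_interpCtx_cons {A : IForm} {Γ : Multiset IForm} {a g : M} (ha : a ∈ interp D A)
    (hg : g ∈ interpCtx D Γ) : a + g ∈ interpCtx D (A ::ₘ Γ) := by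
  rw [interpCtx_cons]
  exact Set.add_mem_add ha hg

theorem interpCtx_map_bang (Γ : Multiset IForm) :
    0 ∈ interpCtx D (Γ.map .bang) ∨ interpCtx D (Γ.map .bang) ⊆ cl D ∅ := by
  induction Γ using Multiset.induction_on with
  | empty => exact Or.inl (by simp [interpCtx])
  | cons B Γ ih =>
    rw [Multiset.map_cons, interpCtx_cons]
    rcases ih with ih | ih
    · by_cases h : (0 : M) ∈ interp D B
      · left
        simpa using Set.add_mem_add (show (0 : M) ∈ interp D (.bang B) from Or.inl h) ih
      · right
        rintro _ ⟨b, hb, g, -, rfl⟩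
        exact add_mem_cl_empty (hb.resolve_left h) g
    · right
      rintro _ ⟨b, -, g, hg, rfl⟩
      simpa [add_comm] using add_mem_cl_empty (ih hg) b

/-- Soundness of ILZW for phase semantics with upward closed predicates. -/
theorem sound (hD : ∀ n m Y, D m Y → D (n + m) Y) {Γ : Multiset IForm} {X : Option IForm}
    (h : IPrv (ILZWc ∅) Γ X) : interpCtx D Γ ⊆ interpStoup D X := by
  induction h with
  | axiom' h => exact h.elim
  | init | botL => simp [interpCtx, interpStoup]
  | oneR | topR => exact Set.subset_univ _
  | zeroL =>
    rw [interpCtx_cons]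
    rintro _ ⟨z, hz, g, -, rfl⟩
    exact cl_empty_subset (cl_interpStoup_subset _) (add_mem_cl_empty hz g)
  | cut _ _ ih₁ ih₂ =>
    rw [interpCtx_add]
    rintro _ ⟨g, hg, d, hd, rfl⟩
    exact ih₂ (add_mem_interpCtx_cons (ih₁ hg) hd)
  | oneL _ _ ih | weakL _ _ _ ih =>
    rw [interpCtx_cons]
    rintro _ ⟨a, -, g, hg, rfl⟩
    exact add_mem_of_closed hD (cl_interpStoup_subset _) a (ih hg)
  | botR _ _ ih => exact ih
  | limpL _ _ _ ih₁ ih₂ =>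
    rw [interpCtx_cons, interpCtx_add]
    rintro _ ⟨f, hf, _, ⟨g, hg, d, hd, rfl⟩, rfl⟩
    have := ih₂ (add_mem_interpCtx_cons (hf g (ih₁ hg)) hd)
    rwa [add_assoc] at this
  | limpR _ _ ih =>
    intro g hg a ha
    rw [add_comm]
    exact ih (add_mem_interpCtx_cons ha hg)
  | tensorL _ _ ih =>
    rw [interpCtx_cons]
    rintro _ ⟨t, ht, g, hg, rfl⟩
    refine add_mem_of_mem_cl (cl_interpStoup_subset _) ht ?_
    rintro _ ⟨a, ha, b, hb, rfl⟩
    have := ih (add_mem_interpCtx_cons ha (add_mem_interpCtx_cons hb hg))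
    rwa [← add_assoc] at this
  | tensorR _ _ _ ih₁ ih₂ =>
    rw [interpCtx_add]
    exact (Set.add_subset_add ih₁ ih₂).trans (subset_cl _)
  | withL1 _ _ ih =>
    rw [interpCtx_cons] at ih ⊢
    exact (Set.add_subset_add_right Set.inter_subset_left).trans ih
  | withL2 _ _ ih =>
    rw [interpCtx_cons] at ih ⊢
    exact (Set.add_subset_add_right Set.inter_subset_right).trans ih
  | withR _ _ _ ih₁ ih₂ => exact Set.subset_inter ih₁ ih₂
  | plusL _ _ _ ih₁ ih₂ =>
    rw [interpCtx_cons]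
    rintro _ ⟨t, ht, g, hg, rfl⟩
    refine add_mem_of_mem_cl (cl_interpStoup_subset _) ht ?_
    rintro s (hs | hs)
    · exact ih₁ (add_mem_interpCtx_cons hs hg)
    · exact ih₂ (add_mem_interpCtx_cons hs hg)
  | plusR1 _ _ ih => exact ih.trans (Set.subset_union_left.trans (subset_cl _))
  | plusR2 _ _ ih => exact ih.trans (Set.subset_union_right.trans (subset_cl _))
  | @bangD Γ X A _ _ _ ih =>
    rw [interpCtx_cons] at ih ⊢
    refine (Set.add_subset_add_right ?_).trans ih
    rintro m (h | h)
    · simpa using add_mem_of_closed hD (cl_interp_subset A) m h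
    · exact cl_empty_subset (cl_interp_subset A) h
  | @bangP Γ A _ _ _ _ ih =>
    intro g hg
    rcases interpCtx_map_bang (D := D) Γ with h | h
    · exact Or.inl (ih h)
    · exact Or.inr (h hg)
  | @bangC Γ X A _ _ ih =>
    rw [interpCtx_cons]
    rintro _ ⟨b, hb, g, hg, rfl⟩
    rcases hb with h | h
    · have h0 : (0 : M) ∈ interp D (.bang A) := Or.inl h
      simpa using ih (add_mem_interpCtx_cons (a := b) (Or.inl h) (add_mem_interpCtx_cons h0 hg))
    · exact cl_empty_subset (cl_interpStoup_subset _) (add_mem_cl_empty h g)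
  | bangF h => exact h.elim
  | bangW h => exact h.elim
  | weakR h => exact h.elim
  | lalBang h => exact h.elim
  | lalPara h => exact h.elim

end Phase

/-! ### The syntactic phase model of `FLei[Φ]` -/

/-- Derivability in `FLei[Φ]`, relativized to antecedents in the language of `FLei`. -/
def FLeiDer (Φ : Set IForm) (Γ : Multiset IForm) (X : Option IForm) : Prop :=
  (∀ A ∈ Γ, A.inFLei) → IPrv (FLeic Φ) Γ X

namespace FLeiDer

open Phase

variable {Φ : Set IForm}

theorem weak (Δ Γ : Multiset IForm) (X : Option IForm) (h : FLeiDer Φ Γ X) :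
    FLeiDer Φ (Δ + Γ) X := fun hK =>
  (h fun A hA => hK A (Multiset.mem_add.2 (Or.inr hA))).weakL_add trivial Δ
    fun A hA => hK A (Multiset.mem_add.2 (Or.inl hA))

theorem cut {Γ Δ : Multiset IForm} {A : IForm} {X : Option IForm} (h₁ : FLeiDer Φ Γ (some A))
    (h₂ : IPrv (FLeic Φ) (A ::ₘ Δ) X) : FLeiDer Φ (Γ + Δ) X := fun hK =>
  .cut (h₁ fun B hB => hK B (Multiset.mem_add.2 (Or.inl hB))) h₂

/-- In the syntactic model every formula of the language of `FLei` is interpreted as the set of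
antecedents deriving it. -/
theorem interp_eq : ∀ {A : IForm}, A.inFLei →
    interp (FLeiDer Φ) A = {Γ | FLeiDer Φ Γ (some A)}
  | .var _, _ => rfl
  | .one, _ => by
    ext Γ
    refine ⟨fun _ => ?_, fun _ => trivial⟩
    simpa using weak Γ 0 (some .one) fun _ => IPrv.oneR (C := FLeic Φ) trivial
  | .bot, _ => by
    ext Γ
    refine ⟨fun h hK => .botR trivial (h hK), fun h => ?_⟩
    have := cut (Δ := 0) h (.botL trivial)
    rwa [add_zero] at this
  | .tensor A B, hAB => by
    have hA := interp_eq hAB.1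
    have hB := interp_eq hAB.2
    apply Set.Subset.antisymm
    · refine cl_subset (cl_setOf_subset _) ?_
      rintro _ ⟨Γ, hΓ, Δ, hΔ, rfl⟩
      rw [hA] at hΓ
      rw [hB] at hΔ
      exact fun hK => .tensorR hAB (hΓ fun C hC => hK C (Multiset.mem_add.2 (Or.inl hC)))
        (hΔ fun C hC => hK C (Multiset.mem_add.2 (Or.inr hC)))
    · intro Γ hΓ Δ Y h hK
      have hs : ({A} + {B} : Multiset IForm) ∈ interp (FLeiDer Φ) A + interp (FLeiDer Φ) B := by
        rw [hA, hB]
        exact Set.add_mem_add (fun _ => .init hAB.1) (fun _ => .init hAB.2)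
      refine cut hΓ (.tensorL hAB ?_) hK
      have := h _ hs fun C hC => ?_
      · simpa [add_assoc] using this
      · simp only [Multiset.mem_add, Multiset.mem_singleton] at hC
        rcases hC with (rfl | rfl) | hC
        exacts [hAB.1, hAB.2, hK C (Multiset.mem_add.2 (Or.inr hC))]
  | .limp A B, hAB => by
    have hA := interp_eq hAB.1
    have hB := interp_eq hAB.2
    ext Γ
    simp only [interp, hA, hB, Set.mem_ofPred_eq]
    constructor
    · intro h hK
      have := h {A} (fun _ => .init hAB.1)
      refine .limpR hAB ?_
      rw [add_comm, Multiset.singleton_add] at this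
      exact this (by simpa using ⟨hAB.1, hK⟩)
    · intro h Δ hΔ hK
      refine cut h ?_ hK
      have := IPrv.limpL hAB (hΔ fun C hC => hK C (Multiset.mem_add.2 (Or.inr hC)))
        (.init (C := FLeic Φ) hAB.2 : IPrv (FLeic Φ) (B ::ₘ 0) _)
      rwa [add_zero] at this
  | .and A B, hAB => by
    ext Γ
    simp only [interp, interp_eq hAB.1, interp_eq hAB.2]
    refine ⟨fun h hK => .withR hAB (h.1 hK) (h.2 hK), fun h => ⟨?_, ?_⟩⟩
    · simpa using cut (Δ := 0) h (.withL1 hAB (.init hAB.1))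
    · simpa using cut (Δ := 0) h (.withL2 hAB (.init hAB.2))
  | .or A B, hAB => by
    have hA := interp_eq hAB.1
    have hB := interp_eq hAB.2
    apply Set.Subset.antisymm
    · refine cl_subset (cl_setOf_subset _) ?_
      rw [hA, hB]
      rintro Γ (h | h)
      exacts [fun hK => .plusR1 hAB (h hK), fun hK => .plusR2 hAB (h hK)]
    · intro Γ hΓ Δ Y h hK
      rw [hA, hB] at h
      have hΔ : ∀ C ∈ Δ, C.inFLei := fun C hC => hK C (Multiset.mem_add.2 (Or.inr hC))
      refine cut hΓ (.plusL hAB ?_ ?_) hK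
      · exact h {A} (Or.inl fun _ => .init hAB.1) (by simpa using ⟨hAB.1, hΔ⟩)
      · exact h {B} (Or.inr fun _ => .init hAB.2) (by simpa using ⟨hAB.2, hΔ⟩)

theorem interpStoup_eq {X : Option IForm} (hX : ∀ A, X = some A → A.inFLei) :
    interpStoup (FLeiDer Φ) X = {Γ | FLeiDer Φ Γ X} := by
  cases X with
  | none => rfl
  | some A => exact interp_eq (hX A rfl)

theorem mem_interpCtx {Γ : Multiset IForm} (hΓ : ∀ A ∈ Γ, A.inFLei) :
    Γ ∈ interpCtx (FLeiDer Φ) Γ := by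
  induction Γ using Multiset.induction_on with
  | empty => simp [interpCtx]
  | cons A Γ ih =>
    have hA : A.inFLei := hΓ A (by simp)
    refine add_mem_interpCtx_cons (a := {A}) ?_ (ih fun B hB => hΓ B (by simp [hB]))
    rw [interp_eq hA]
    exact fun _ => .init hA

theorem zero_mem_interpCtx_map_bang {Ψ : Multiset IForm} (hΨ : ∀ B ∈ Ψ, B.inFLei)
    (hΨΦ : ∀ B ∈ Ψ, B ∈ Φ) : 0 ∈ interpCtx (FLeiDer Φ) (Ψ.map .bang) := by
  induction Ψ using Multiset.induction_on with
  | empty => simp [interpCtx]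
  | cons B Ψ ih =>
    rw [Multiset.map_cons]
    have h0 : (0 : Multiset IForm) ∈ interp (FLeiDer Φ) (.bang B) := by
      left
      rw [interp_eq (hΨ B (by simp))]
      exact fun _ => .axiom' (hΨΦ B (by simp))
    simpa using add_mem_interpCtx_cons h0
      (ih (fun C hC => hΨ C (by simp [hC])) fun C hC => hΨΦ C (by simp [hC]))

end FLeiDer

end Affine

namespace Affine
/-- `Γ ⊢ X` is provable in FLei[Φ] iff `!Φ,Γ ⊢ X` is provable in ILZW. -/
theorem flei_deducibility_iff_ilzw (Φ : Finset IForm) (Γ : Multiset IForm)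
    (X : Option IForm)
    (hΦ : ∀ B ∈ Φ, B.inFLei) (hΓ : ∀ A ∈ Γ, A.inFLei)
    (hX : ∀ A, X = some A → A.inFLei) :
    IPrv (FLeic ↑Φ) Γ X ↔ IPrv (ILZWc ∅) (Φ.val.map IForm.bang + Γ) X := by
  refine ⟨IPrv.ilzw_of_flei hΦ, fun h => ?_⟩
  have hs := Phase.sound (D := FLeiDer (↑Φ : Set IForm)) FLeiDer.weak h
  rw [Phase.interpCtx_add, FLeiDer.interpStoup_eq hX] at hs
  have := hs (Set.add_mem_add
    (FLeiDer.zero_mem_interpCtx_map_bang hΦ fun B hB => hB) (FLeiDer.mem_interpCtx hΓ))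
  rw [zero_add] at this
  exact this hΓ
end Affine
end

section
/- Let !Γ,Δ ⊢ A be a !-prenex {⊸}-sequent. The following are mutually equivalent: (1) !Γ,Δ ⊢ A is provable in the {⊸,!}-fragment of ILLW; (2) Δ ⊢ A is provable in BCK[σ(Γ)]; (3) Δ ⊢ A is provable in FLei⁺[σ(Γ)]; (4) Δ ⊢ A is provable in FLei[σ(Γ)]; (5) Δ ⊢ A is provable in FLew[σ(Γ)]. -/
namespace Affine

open scoped Pointwise

/-- Provability is monotone in the calculus. -/
theorem IPrv.mono {C D : ICalc} (hK : ∀ A, C.K A → D.K A) (hax : C.ax ⊆ D.ax)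
    (hwL : C.wL → D.wL) (hwR : C.wR → D.wR) (hbD : C.bD → D.bD) (hbP : C.bP → D.bP)
    (hbF : C.bF → D.bF) (hbW : C.bW → D.bW) (hlB : C.lB → D.lB) (hlP : C.lP → D.lP)
    {Γ : Multiset IForm} {X : Option IForm} (h : IPrv C Γ X) : IPrv D Γ X := by
  induction h with
  | axiom' h => exact .axiom' (hax h)
  | init h => exact .init (hK _ h)
  | oneR h => exact .oneR (hK _ h)
  | botL h => exact .botL (hK _ h)
  | topR h h' => exact .topR (hK _ h) fun A hA => hK _ (h' A hA)
  | zeroL h h' h'' =>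
    exact .zeroL (hK _ h) (fun A hA => hK _ (h' A hA)) fun A hA => hK _ (h'' A hA)
  | cut _ _ ih₁ ih₂ => exact .cut ih₁ ih₂
  | oneL h _ ih => exact .oneL (hK _ h) ih
  | botR h _ ih => exact .botR (hK _ h) ih
  | limpL h _ _ ih₁ ih₂ => exact .limpL (hK _ h) ih₁ ih₂
  | limpR h _ ih => exact .limpR (hK _ h) ih
  | tensorL h _ ih => exact .tensorL (hK _ h) ih
  | tensorR h _ _ ih₁ ih₂ => exact .tensorR (hK _ h) ih₁ ih₂
  | withL1 h _ ih => exact .withL1 (hK _ h) ih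
  | withL2 h _ ih => exact .withL2 (hK _ h) ih
  | withR h _ _ ih₁ ih₂ => exact .withR (hK _ h) ih₁ ih₂
  | plusL h _ _ ih₁ ih₂ => exact .plusL (hK _ h) ih₁ ih₂
  | plusR1 h _ ih => exact .plusR1 (hK _ h) ih
  | plusR2 h _ ih => exact .plusR2 (hK _ h) ih
  | bangD hr h _ ih => exact .bangD (hbD hr) (hK _ h) ih
  | bangP hr h h' _ ih => exact .bangP (hbP hr) (hK _ h) (fun B hB => hK _ (h' B hB)) ih
  | bangF hr h h' _ ih => exact .bangF (hbF hr) (hK _ h) (fun B hB => hK _ (h' B hB)) ih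
  | weakL hr h _ ih => exact .weakL (hwL hr) (hK _ h) ih
  | bangW hr h _ ih => exact .bangW (hbW hr) (hK _ h) ih
  | bangC h _ ih => exact .bangC (hK _ h) ih
  | weakR hr h _ ih => exact .weakR (hwR hr) (hK _ h) ih
  | lalBang hr h h' hc _ ih =>
    exact .lalBang (hlB hr) (hK _ h) (fun B hB => hK _ (h' B hB)) hc ih
  | lalPara hr h h' h'' _ ih =>
    exact .lalPara (hlP hr) (hK _ h) (fun B hB => hK _ (h' B hB))
      (fun B hB => hK _ (h'' B hB)) ih

/-- Weakening by a multiset of formulas. -/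
theorem IPrv.weak_add {C : ICalc} (hw : C.wL) {Δ : Multiset IForm} {X : Option IForm}
    (h : IPrv C Δ X) (Γ : Multiset IForm) (hΓ : ∀ B ∈ Γ, C.K B) : IPrv C (Γ + Δ) X := by
  induction Γ using Multiset.induction_on with
  | empty => simpa using h
  | cons B Γ ih =>
    rw [Multiset.cons_add]
    exact .weakL hw (hΓ B (by simp)) (ih fun A hA => hΓ A (by simp [hA]))

/-- Contraction of a multiset of banged formulas. -/
theorem IPrv.contract_add {C : ICalc} {X : Option IForm} (Γ : Multiset IForm)
    (hΓ : ∀ B ∈ Γ, C.K (.bang B)) {Δ : Multiset IForm}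
    (h : IPrv C (Γ.map .bang + (Γ.map .bang + Δ)) X) : IPrv C (Γ.map .bang + Δ) X := by
  induction Γ using Multiset.induction_on generalizing Δ with
  | empty => simpa using h
  | cons B Γ ih =>
    rw [Multiset.map_cons, Multiset.cons_add]
    refine .bangC (hΓ B (by simp)) ?_
    have := ih (fun A hA => hΓ A (by simp [hA])) (Δ := .bang B ::ₘ .bang B ::ₘ Δ) (by
      simpa [Multiset.map_cons, Multiset.cons_add, Multiset.add_cons] using h)
    simpa [Multiset.add_cons] using this

theorem IForm.inImp.inImpBang {A : IForm} (h : A.inImp) : A.inImpBang := by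
  induction A with
  | limp A B ihA ihB => exact ⟨ihA h.1, ihB h.2⟩
  | var => trivial
  | _ => exact h.elim

theorem IForm.inImp.inFLeiP {A : IForm} (h : A.inImp) : A.inFLeiP := by
  induction A with
  | limp A B ihA ihB => exact ⟨ihA h.1, ihB h.2⟩
  | var => trivial
  | _ => exact h.elim

theorem IForm.inFLeiP.inFLei {A : IForm} (h : A.inFLeiP) : A.inFLei := by
  induction A with
  | limp A B ihA ihB | tensor A B ihA ihB | and A B ihA ihB | or A B ihA ihB =>
    exact ⟨ihA h.1, ihB h.2⟩
  | var | one => trivial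
  | _ => exact h.elim

/-- Axioms of BCK can be internalized as banged hypotheses. -/
theorem IPrv.internalize {Γ Δ : Multiset IForm} {X : Option IForm}
    (hΓ : ∀ B ∈ Γ, B.inImp) (h : IPrv (BCKc {B | B ∈ Γ}) Δ X) :
    IPrv (ImpBangILLWc ∅) (Γ.map .bang + Δ) X := by
  have hb : ∀ B ∈ Γ, (ImpBangILLWc ∅).K (.bang B) := fun B hB => (hΓ B hB).inImpBang
  have hb' : ∀ B ∈ Γ.map IForm.bang, (ImpBangILLWc ∅).K B := by
    intro B hB
    obtain ⟨A, hA, rfl⟩ := Multiset.mem_map.1 hB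
    exact hb A hA
  induction h with
  | @axiom' B h =>
    obtain ⟨Γ', rfl⟩ := Multiset.exists_cons_of_mem h
    rw [add_zero, Multiset.map_cons]
    refine .bangD trivial (hb B h) ?_
    rw [← Multiset.singleton_add, add_comm]
    exact .weak_add trivial (.init (hΓ B h).inImpBang) _ fun A hA => hb' A (by simp_all)
  | init h => exact .weak_add trivial (.init h.inImpBang) _ hb'
  | @cut Θ Ξ X A _ _ ih₁ ih₂ =>
    refine .contract_add Γ hb ?_
    rw [Multiset.add_cons] at ih₂
    convert IPrv.cut ih₁ ih₂ using 1
    abel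
  | @limpL Θ Ξ X A B hK _ _ ih₁ ih₂ =>
    refine .contract_add Γ hb ?_
    rw [Multiset.add_cons] at ih₂
    convert IPrv.limpL (IForm.inImp.inImpBang hK) ih₁ ih₂ using 1
    simp only [← Multiset.singleton_add]
    abel
  | limpR hK _ ih =>
    rw [Multiset.add_cons] at ih
    exact .limpR (IForm.inImp.inImpBang hK) ih
  | weakL _ hK _ ih =>
    rw [Multiset.add_cons]
    exact .weakL trivial (IForm.inImp.inImpBang hK) ih
  | bangF hr | weakR hr | bangW hr | lalBang hr | lalPara hr => exact hr.elim
  | oneR hK | botL hK | topR hK | zeroL hK | oneL hK | botR hK | tensorL hK | tensorR hK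
  | withL1 hK | withL2 hK | withR hK | plusL hK | plusR1 hK | plusR2 hK | bangC hK =>
    exact False.elim hK
  | bangD _ hK | bangP _ hK => exact False.elim hK

/-- Derivability in BCK with axioms `Φ`, holding vacuously for antecedents that are not
purely implicational. -/
def Der (Φ : Set IForm) (m : Multiset IForm) (C : IForm) : Prop :=
  (∀ B ∈ m, B.inImp) → IPrv (BCKc Φ) m (some C)

theorem Der.weak {Φ : Set IForm} {m : Multiset IForm} {C : IForm} (h : Der Φ m C)
    (n : Multiset IForm) : Der Φ (n + m) C := fun hi =>
  .weak_add trivial (h fun B hB => hi B (by simp [hB])) _ fun B hB => hi B (by simp [hB])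

/-- The closure operator generated by the sets of antecedents `m` with `m, Δ ⊢ C` derivable. -/
def cl (Φ : Set IForm) (X : Set (Multiset IForm)) : Set (Multiset IForm) :=
  {m | ∀ Δ C, C.inImp → (∀ x ∈ X, Der Φ (x + Δ) C) → Der Φ (m + Δ) C}

section Closure

variable {Φ : Set IForm} {X Y Z : Set (Multiset IForm)}

theorem subset_cl : X ⊆ cl Φ X := fun x hx _ _ _ h => h x hx

theorem cl_mono (h : X ⊆ Y) : cl Φ X ⊆ cl Φ Y := fun _ hm Δ C hC hY =>
  hm Δ C hC fun x hx => hY x (h hx)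

theorem cl_cl : cl Φ (cl Φ X) ⊆ cl Φ X := fun _ hm Δ C hC hX =>
  hm Δ C hC fun _ hx => hx Δ C hC hX

theorem cl_add_subset (hZ : cl Φ Z ⊆ Z) (h : X + Y ⊆ Z) : cl Φ X + Y ⊆ Z := by
  rintro _ ⟨x, hx, y, hy, rfl⟩
  refine hZ fun Δ C hC hd => ?_
  have := hx (y + Δ) C hC fun x' hx' => by
    rw [← add_assoc]
    exact hd _ (h (Set.add_mem_add hx' hy))
  simpa only [add_assoc] using this

theorem cl_subset (hZ : cl Φ Z ⊆ Z) (h : X ⊆ Z) : cl Φ X ⊆ Z := (cl_mono h).trans hZ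

theorem add_mem_of_closed (hZ : cl Φ Z ⊆ Z) {m : Multiset IForm} (hm : m ∈ Z)
    (n : Multiset IForm) : n + m ∈ Z :=
  hZ fun Δ _ _ hd => by
    rw [add_assoc]
    exact (hd m hm).weak n

end Closure

/-- Phase semantics over BCK with axioms `Φ`. -/
def sem (Φ : Set IForm) : IForm → Set (Multiset IForm)
  | .var n => {m | Der Φ m (.var n)}
  | .one => Set.univ
  | .top => Set.univ
  | .bot => cl Φ ∅
  | .zero => cl Φ ∅
  | .tensor A B => cl Φ (sem Φ A + sem Φ B)
  | .limp A B => {m | ∀ a ∈ sem Φ A, a + m ∈ sem Φ B}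
  | .and A B => sem Φ A ∩ sem Φ B
  | .or A B => cl Φ (sem Φ A ∪ sem Φ B)
  | .bang A => cl Φ {m | m = 0 ∧ 0 ∈ sem Φ A}
  | .para A => sem Φ A

theorem sem_closed (Φ : Set IForm) (A : IForm) : cl Φ (sem Φ A) ⊆ sem Φ A := by
  induction A with
  | var n =>
    intro m hm
    have := hm 0 (.var n) trivial fun x hx => by rw [add_zero]; exact hx
    rwa [add_zero] at this
  | one | top => exact Set.subset_univ _
  | bot | zero | tensor | or | bang => exact cl_cl
  | limp A B _ ihB =>
    intro m hm a ha
    refine ihB fun Δ C hC hd => ?_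
    have := hm (a + Δ) C hC fun x hx => by
      rw [← add_assoc, add_comm x a]
      exact hd _ (hx a ha)
    rwa [← add_assoc, add_comm m a] at this
  | and A B ihA ihB =>
    exact fun m hm => ⟨ihA (cl_mono Set.inter_subset_left hm),
      ihB (cl_mono Set.inter_subset_right hm)⟩
  | para A ih => exact ih

/-- Interpretation of a stoup. -/
def semStoup (Φ : Set IForm) : Option IForm → Set (Multiset IForm)
  | none => cl Φ ∅
  | some A => sem Φ A

theorem semStoup_closed (Φ : Set IForm) (X : Option IForm) :
    cl Φ (semStoup Φ X) ⊆ semStoup Φ X := by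
  cases X with
  | none => exact cl_cl
  | some A => exact sem_closed Φ A

/-- Interpretation of an antecedent. -/
def ctx (Φ : Set IForm) (Γ : Multiset IForm) : Set (Multiset IForm) := (Γ.map (sem Φ)).sum

section Context

variable {Φ : Set IForm}

@[simp] theorem ctx_zero : ctx Φ 0 = {0} := rfl

@[simp] theorem ctx_cons (A : IForm) (Γ : Multiset IForm) :
    ctx Φ (A ::ₘ Γ) = sem Φ A + ctx Φ Γ := by simp [ctx]

@[simp] theorem ctx_singleton (A : IForm) : ctx Φ {A} = sem Φ A := by simp [ctx]

@[simp] theorem ctx_add (Γ Δ : Multiset IForm) : ctx Φ (Γ + Δ) = ctx Φ Γ + ctx Φ Δ := by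
  simp [ctx]

theorem zero_mem_ctx {Γ : Multiset IForm} (h : ∀ B ∈ Γ, 0 ∈ sem Φ B) : 0 ∈ ctx Φ Γ := by
  induction Γ using Multiset.induction_on with
  | empty => simp
  | cons B Γ ih =>
    rw [ctx_cons]
    exact ⟨0, h B (by simp), 0, ih fun A hA => h A (by simp [hA]), add_zero 0⟩

theorem zero_mem_sem_bang {A : IForm} (h : 0 ∈ sem Φ A) : 0 ∈ sem Φ (.bang A) :=
  subset_cl ⟨rfl, h⟩

theorem sem_bang_subset (A : IForm) : sem Φ (.bang A) ⊆ sem Φ A :=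
  cl_subset (sem_closed Φ A) fun _ hm => hm.1 ▸ hm.2

theorem zero_mem_ctx_map_bang {Γ : Multiset IForm} (h : ∀ B ∈ Γ, 0 ∈ sem Φ B) :
    0 ∈ ctx Φ (Γ.map .bang) :=
  zero_mem_ctx fun B hB => by
    obtain ⟨A, hA, rfl⟩ := Multiset.mem_map.1 hB
    exact zero_mem_sem_bang (h A hA)

theorem ctx_map_bang_subset_ctx (Γ : Multiset IForm) : ctx Φ (Γ.map .bang) ⊆ ctx Φ Γ := by
  induction Γ using Multiset.induction_on with
  | empty => simp
  | cons B Γ ih =>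
    rw [Multiset.map_cons, ctx_cons, ctx_cons]
    exact Set.add_subset_add (sem_bang_subset B) ih

theorem ctx_map_para (Γ : Multiset IForm) : ctx Φ (Γ.map .para) = ctx Φ Γ := by
  rw [ctx, ctx, Multiset.map_map]
  rfl

/-- A closed set contains the interpretation of a banged antecedent as soon as it contains
`0` whenever all formulas of the antecedent are valid. -/
theorem ctx_map_bang_subset {Γ : Multiset IForm} {Z : Set (Multiset IForm)}
    (hZ : cl Φ Z ⊆ Z) (h : (∀ B ∈ Γ, 0 ∈ sem Φ B) → 0 ∈ Z) : ctx Φ (Γ.map .bang) ⊆ Z := by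
  induction Γ using Multiset.induction_on with
  | empty => simpa using h
  | cons B Γ ih =>
    rw [Multiset.map_cons, ctx_cons]
    refine cl_add_subset hZ ?_
    rintro _ ⟨_, ⟨rfl, hB⟩, y, hy, rfl⟩
    simp only [zero_add]
    exact ih (fun hΓ => h (by simpa [hB] using hΓ)) hy

theorem ctx_map_bang_subset_sem_bang {Γ : Multiset IForm} {A : IForm}
    (h : (∀ B ∈ Γ, 0 ∈ sem Φ B) → 0 ∈ sem Φ A) : ctx Φ (Γ.map .bang) ⊆ sem Φ (.bang A) :=
  ctx_map_bang_subset (sem_closed Φ _) fun hΓ => zero_mem_sem_bang (h hΓ)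

end Context

/-- Soundness of the phase semantics for every calculus whose axioms are valid. -/
theorem IPrv.sound {Φ : Set IForm} {C : ICalc} (hax : ∀ B ∈ C.ax, 0 ∈ sem Φ B)
    {Γ : Multiset IForm} {X : Option IForm} (h : IPrv C Γ X) :
    ctx Φ Γ ⊆ semStoup Φ X := by
  have elim {X Y : Set (Multiset IForm)} {Z : Option IForm} (h : X + Y ⊆ semStoup Φ Z) :
      cl Φ X + Y ⊆ semStoup Φ Z := cl_add_subset (semStoup_closed Φ Z) h
  have bot_elim {Y : Set (Multiset IForm)} {Z : Option IForm} :
      cl Φ ∅ + Y ⊆ semStoup Φ Z := elim (by simp)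
  induction h with
  | axiom' h => simpa [semStoup] using hax _ h
  | init | botL => simp [semStoup, sem]
  | oneR | topR => exact Set.subset_univ _
  | zeroL => rw [ctx_cons]; exact bot_elim
  | cut _ _ ih₁ ih₂ =>
    rw [ctx_cons] at ih₂
    rw [ctx_add]
    exact (Set.add_subset_add_right ih₁).trans ih₂
  | oneL _ _ ih | weakL _ _ _ ih | bangW _ _ _ ih =>
    rw [ctx_cons]
    rintro _ ⟨a, -, y, hy, rfl⟩
    exact add_mem_of_closed (semStoup_closed Φ _) (ih hy) a
  | botR _ _ ih => exact ih
  | @limpL Γ Δ X A B _ _ _ ih₁ ih₂ =>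
    rw [ctx_cons] at ih₂
    rw [ctx_cons, ctx_add]
    rintro _ ⟨f, hf, _, ⟨x, hx, y, hy, rfl⟩, rfl⟩
    have := ih₂ (Set.add_mem_add (hf x (ih₁ hx)) hy)
    convert this using 1
    simp only
    abel
  | limpR _ _ ih =>
    rw [ctx_cons] at ih
    exact fun m hm a ha => ih (Set.add_mem_add ha hm)
  | tensorL _ _ ih =>
    rw [ctx_cons, ctx_cons, ← add_assoc] at ih
    rw [ctx_cons]
    exact elim ih
  | tensorR _ _ _ ih₁ ih₂ =>
    rw [ctx_add]
    exact (Set.add_subset_add ih₁ ih₂).trans subset_cl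
  | withL1 _ _ ih =>
    rw [ctx_cons] at *
    exact (Set.add_subset_add_right Set.inter_subset_left).trans ih
  | withL2 _ _ ih =>
    rw [ctx_cons] at *
    exact (Set.add_subset_add_right Set.inter_subset_right).trans ih
  | withR _ _ _ ih₁ ih₂ => exact Set.subset_inter ih₁ ih₂
  | plusL _ _ _ ih₁ ih₂ =>
    rw [ctx_cons] at *
    refine elim ?_
    rw [Set.union_add]
    exact Set.union_subset ih₁ ih₂
  | plusR1 _ _ ih => exact ih.trans (Set.subset_union_left.trans subset_cl)
  | plusR2 _ _ ih => exact ih.trans (Set.subset_union_right.trans subset_cl)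
  | bangD _ _ _ ih =>
    rw [ctx_cons] at *
    exact (Set.add_subset_add_right (sem_bang_subset _)).trans ih
  | bangP _ _ _ _ ih =>
    exact ctx_map_bang_subset_sem_bang fun hΓ => ih (zero_mem_ctx_map_bang hΓ)
  | bangF _ _ _ _ ih | lalBang _ _ _ _ _ ih =>
    exact ctx_map_bang_subset_sem_bang fun hΓ => ih (zero_mem_ctx hΓ)
  | bangC _ _ ih =>
    rw [ctx_cons, ctx_cons] at ih
    rw [ctx_cons]
    refine elim ?_
    rintro _ ⟨_, ⟨rfl, hA⟩, y, hy, rfl⟩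
    have h0 := zero_mem_sem_bang hA
    simpa using ih (Set.add_mem_add h0 (Set.add_mem_add h0 hy))
  | weakR _ _ _ ih =>
    exact ih.trans (cl_subset (semStoup_closed Φ _) (Set.empty_subset _))
  | lalPara _ _ _ _ _ ih =>
    rw [ctx_add] at *
    rw [ctx_map_para]
    exact (Set.add_subset_add_right (ctx_map_bang_subset_ctx _)).trans ih

/-- Implicational formulas are interpreted by the antecedents deriving them. -/
theorem mem_sem_iff_der {Φ : Set IForm} {A : IForm} (hA : A.inImp) (m : Multiset IForm) :
    m ∈ sem Φ A ↔ Der Φ m A := by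
  induction A generalizing m with
  | var => exact Iff.rfl
  | limp A B ihA ihB =>
    constructor
    · intro h hm
      have hAA : ({A} : Multiset IForm) ∈ sem Φ A := (ihA hA.1 _).2 fun _ => .init hA.1
      refine .limpR hA ((ihB hA.2 _).1 (h _ hAA) ?_)
      intro C hC
      rcases Multiset.mem_cons.1 hC with rfl | hC
      · exact hA.1
      · exact hm C hC
    · intro h a ha
      refine (ihB hA.2 _).2 fun hi => ?_
      have h₁ := (ihA hA.1 a).1 ha fun C hC => hi C (by simp [hC])
      have h₂ := h fun C hC => hi C (by simp [hC])
      have h₃ : IPrv (BCKc Φ) (.limp A B ::ₘ (a + 0)) (some B) :=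
        .limpL hA h₁ (.init hA.2)
      rw [add_zero] at h₃
      rw [add_comm]
      exact .cut h₂ h₃
  | _ => exact hA.elim

theorem self_mem_ctx {Φ : Set IForm} {Δ : Multiset IForm} (hΔ : ∀ B ∈ Δ, B.inImp) :
    Δ ∈ ctx Φ Δ := by
  induction Δ using Multiset.induction_on with
  | empty => simp
  | cons B Δ ih =>
    have hB : B.inImp := hΔ B (by simp)
    rw [ctx_cons, ← Multiset.singleton_add]
    exact Set.add_mem_add ((mem_sem_iff_der hB _).2 fun _ => .init hB)
      (ih fun A hA => hΔ A (by simp [hA]))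

/-- For a !-prenex {⊸}-sequent `!Γ,Δ ⊢ A` the following are equivalent:
(1) `!Γ,Δ ⊢ A` is provable in the {⊸,!}-fragment of ILLW;
(2) `Δ ⊢ A` is provable in BCK[σ(Γ)];
(3) `Δ ⊢ A` is provable in FLei⁺[σ(Γ)];
(4) `Δ ⊢ A` is provable in FLei[σ(Γ)];
(5) `Δ ⊢ A` is provable in FLew[σ(Γ)]. -/
theorem prenex_imp_tfae (Γ Δ : Multiset IForm) (A : IForm)
    (hΓ : ∀ B ∈ Γ, B.inImp) (hΔ : ∀ B ∈ Δ, B.inImp) (hA : A.inImp) :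
    [IPrv (ImpBangILLWc ∅) (Γ.map IForm.bang + Δ) (some A),
     IPrv (BCKc {B | B ∈ Γ}) Δ (some A),
     IPrv (FLeiPc {B | B ∈ Γ}) Δ (some A),
     IPrv (FLeic {B | B ∈ Γ}) Δ (some A),
     IPrv (FLewc {B | B ∈ Γ}) Δ (some A)].TFAE := by
  have valid : ∀ B ∈ Γ, 0 ∈ sem {B | B ∈ Γ} B := fun B hB =>
    (mem_sem_iff_der (hΓ B hB) 0).2 fun _ => .axiom' hB
  tfae_have 1 → 2 := by
    intro h
    have hs := h.sound (Φ := {B | B ∈ Γ}) fun B hB => (Set.notMem_empty B hB).elim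
    rw [ctx_add] at hs
    have hm := hs (Set.add_mem_add (zero_mem_ctx_map_bang valid) (self_mem_ctx hΔ))
    rw [zero_add] at hm
    exact (mem_sem_iff_der hA Δ).1 hm hΔ
  tfae_have 2 → 1 := IPrv.internalize hΓ
  tfae_have 2 → 3 := fun h =>
    h.mono (C := BCKc _) (D := FLeiPc _)
      (fun _ => IForm.inImp.inFLeiP) (fun _ hB => hB) id id id id id id id id
  tfae_have 3 → 4 := fun h =>
    h.mono (C := FLeiPc _) (D := FLeic _)
      (fun _ => IForm.inFLeiP.inFLei) (fun _ hB => hB) id id id id id id id id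
  tfae_have 4 → 5 := fun h =>
    h.mono (C := FLeic _) (D := FLewc _)
      (fun _ => id) (fun _ hB => hB) id (fun _ => trivial) id id id id id id
  tfae_have 5 → 2 := fun h =>
    (mem_sem_iff_der hA Δ).1 (h.sound (Φ := {B | B ∈ Γ}) valid (self_mem_ctx hΔ)) hΔ
  tfae_finish

end Affine
end
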